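/- Let K₁ and K₂ be geometric simplicial triangulations of the round 3-sphere S³ (triangulations by spherical geodesic simplices) such that in each K_i the star of every simplex has diameter less than π. Then K₁ and K₂ are related by a finite sequence of geometric bistellar moves (no derived subdivisions are needed). -/

import Mathlib

open Set
open scoped Classical RealInnerProductSpace

/-- The spherical geodesic simplex spanned by a finite set `s` of unit vectors: the radial
projection to the unit sphere of the convex hull of `s`. -/
noncomputable def sphSimplex {m : ℕ} (s : Finset (EuclideanSpace ℝ (Fin m))) :
    Set (EuclideanSpace ℝ (Fin m)) :=
  (fun y => ‖y‖⁻¹ • y) '' (convexHull ℝ (s : Set (EuclideanSpace ℝ (Fin m))) \ {0})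

/-- A geometric (spherical) simplicial complex in the unit sphere `Sⁿ ⊂ ℝ^{n+1}`: a finite
collection of spherical geodesic simplices, recorded by their (linearly independent) vertex
sets of unit vectors, closed under passing to faces, and such that any two simplices intersect
in the (possibly empty) common face spanned by their common vertices. -/
structure SphericalComplex (n : ℕ) where
  faces : Set (Finset (EuclideanSpace ℝ (Fin (n + 1))))
  finite' : faces.Finite
  nonempty_mem : ∀ s ∈ faces, s.Nonempty
  unit : ∀ s ∈ faces, ∀ v ∈ s, ‖v‖ = 1
  indep : ∀ s ∈ faces, LinearIndependent ℝ
    (fun v : {x // x ∈ s} => (v : EuclideanSpace ℝ (Fin (n + 1))))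
  down_closed : ∀ s ∈ faces, ∀ t, t ⊆ s → t.Nonempty → t ∈ faces
  inter : ∀ s ∈ faces, ∀ t ∈ faces, sphSimplex s ∩ sphSimplex t = sphSimplex (s ∩ t)

/-- The support of a spherical complex. -/
def SphericalComplex.space {n : ℕ} (K : SphericalComplex n) :
    Set (EuclideanSpace ℝ (Fin (n + 1))) :=
  ⋃ s ∈ K.faces, sphSimplex s

/-- The (relative) interior of a spherical simplex: the simplex minus its proper faces. -/
noncomputable def sphInterior {m : ℕ} (s : Finset (EuclideanSpace ℝ (Fin m))) :
    Set (EuclideanSpace ℝ (Fin m)) :=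
  sphSimplex s \ ⋃ t ∈ {t : Finset (EuclideanSpace ℝ (Fin m)) | t ⊂ s}, sphSimplex t

/-- The star of a simplex `A` in a spherical complex `K`, as a subset of the sphere: the union
of the (closed) simplices of `K` containing `A`. -/
def sphStar {n : ℕ} (K : SphericalComplex n) (A : Finset (EuclideanSpace ℝ (Fin (n + 1)))) :
    Set (EuclideanSpace ℝ (Fin (n + 1))) :=
  ⋃ t ∈ {t | t ∈ K.faces ∧ A ⊆ t}, sphSimplex t

/-- `K'` is a derived subdivision of the spherical complex `K`: an interior point `b A` of each
simplex `A` of `K` is chosen, and the simplices of `K'` are the geodesic joins of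
`{b A₀, …, b Aₖ}` over chains `A₀ ⊊ ⋯ ⊊ Aₖ` of simplices of `K`. -/
def SphIsDerived {n : ℕ} (K' K : SphericalComplex n) : Prop :=
  ∃ b : Finset (EuclideanSpace ℝ (Fin (n + 1))) → EuclideanSpace ℝ (Fin (n + 1)),
    (∀ s ∈ K.faces, b s ∈ sphInterior s) ∧
    K'.faces = {S | ∃ T : Finset (Finset (EuclideanSpace ℝ (Fin (n + 1)))),
      ↑T ⊆ K.faces ∧ T.Nonempty ∧ (∀ A ∈ T, ∀ B ∈ T, A ⊆ B ∨ B ⊆ A) ∧ S = T.image b}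

/-- `K'` is an `s`-fold iterated derived subdivision of the spherical complex `K`. -/
def SphIterDerived {n : ℕ} : ℕ → SphericalComplex n → SphericalComplex n → Prop
  | 0, K', K => K' = K
  | (s + 1), K', K => ∃ K'', SphIterDerived s K'' K ∧ SphIsDerived K' K''

/-- The geometric bistellar move `κ(A,B)` on a spherical complex triangulating `Sⁿ`: `A` is a
simplex of `K`, `B` a spherical simplex not in `K` with `dim A + dim B = n`, the link of `A`
in `K` is the boundary complex of `B`, and `K'` is obtained by replacing `A ⋆ ∂B` with
`∂A ⋆ B` (joins being geodesic). -/
def SphBistellarMove {n : ℕ} (K K' : SphericalComplex n) : Prop :=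
  ∃ A B : Finset (EuclideanSpace ℝ (Fin (n + 1))), A ∈ K.faces ∧ B ∉ K.faces ∧ B.Nonempty ∧
    A.card + B.card = n + 2 ∧
    {C : Finset (EuclideanSpace ℝ (Fin (n + 1))) |
        C.Nonempty ∧ Disjoint A C ∧ A ∪ C ∈ K.faces} =
      {C : Finset (EuclideanSpace ℝ (Fin (n + 1))) | C.Nonempty ∧ C ⊂ B} ∧
    K'.faces = (K.faces \ {s | A ⊆ s}) ∪
      {s | ∃ A' : Finset (EuclideanSpace ℝ (Fin (n + 1))), A' ⊂ A ∧ s = A' ∪ B}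

set_option linter.unusedSectionVars false

namespace SphFan

open Module

section Fan

variable {V : Type*} [NormedAddCommGroup V] [InnerProductSpace ℝ V]

/-- The vector with coefficients `c`. -/
noncomputable abbrev comb : (V →₀ ℝ) →ₗ[ℝ] V := Finsupp.linearCombination ℝ (id : V → V)

/-- The coefficient function equal to one on `s` and zero elsewhere. -/
noncomputable def ones (s : Finset V) : V →₀ ℝ := Finsupp.indicator s fun _ _ => 1

lemma ones_apply (s : Finset V) (v : V) : ones s v = if v ∈ s then 1 else 0 := by
  simp [ones, Finsupp.indicator_apply]

variable [DecidableEq V]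

/-- A complete simplicial fan whose rays are recorded by unit vectors and whose cones are recorded
by their sets of rays: every vector is a nonnegative combination of the rays of some cone, in a
unique way. -/
structure IsFan (F : Set (Finset V)) : Prop where
  finite : F.Finite
  empty_mem : ∅ ∈ F
  down : ∀ s ∈ F, ∀ t ⊆ s, t ∈ F
  unit : ∀ s ∈ F, ∀ v ∈ s, ‖v‖ = 1
  inj : ∀ c d : V →₀ ℝ, (∀ v, 0 ≤ c v) → (∀ v, 0 ≤ d v) → c.support ∈ F → d.support ∈ F →
    comb c = comb d → c = d
  surj : ∀ x, ∃ c : V →₀ ℝ, (∀ v, 0 ≤ c v) ∧ c.support ∈ F ∧ comb c = x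

variable {F : Set (Finset V)}

lemma IsFan.star_unique (hF : IsFan F) {s : Finset V} {k k' : V →₀ ℝ}
    (hk : ∀ v ∉ s, 0 ≤ k v) (hk' : ∀ v ∉ s, 0 ≤ k' v) (hs : s ∪ k.support ∈ F)
    (hs' : s ∪ k'.support ∈ F) (h : comb k = comb k') : k = k' := by
  set M : ℝ := ∑ v ∈ s, (|k v| + |k' v|) with hM
  have hle : ∀ v ∈ s, |k v| + |k' v| ≤ M := fun v hv =>
    Finset.single_le_sum (f := fun v => |k v| + |k' v|) (fun i _ => by positivity) hv
  have key : k + M • ones s = k' + M • ones s := by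
    apply hF.inj
    · intro v
      by_cases hv : v ∈ s
      · have := hle v hv
        have h1 := neg_abs_le (k v)
        have h2 := abs_nonneg (k' v)
        simp [ones_apply, hv]; linarith
      · simpa [ones_apply, hv] using hk v hv
    · intro v
      by_cases hv : v ∈ s
      · have := hle v hv
        have h1 := neg_abs_le (k' v)
        have h2 := abs_nonneg (k v)
        simp [ones_apply, hv]; linarith
      · simpa [ones_apply, hv] using hk' v hv
    · refine hF.down _ hs _ fun v hv => ?_
      by_cases hvs : v ∈ s
      · simp [hvs]
      · simpa [ones_apply, hvs] using hv
    · refine hF.down _ hs' _ fun v hv => ?_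
      by_cases hvs : v ∈ s
      · simp [hvs]
      · simpa [ones_apply, hvs] using hv
    · simp only [map_add, h]
  exact add_right_cancel key

lemma IsFan.indep (hF : IsFan F) {s : Finset V} (hs : s ∈ F) {k k' : V →₀ ℝ}
    (hk : k.support ⊆ s) (hk' : k'.support ⊆ s) (h : comb k = comb k') : k = k' := by
  refine hF.star_unique (s := s) (fun v hv => ?_) (fun v hv => ?_) ?_ ?_ h
  · rw [Finsupp.notMem_support_iff.1 fun h => hv (hk h)]
  · rw [Finsupp.notMem_support_iff.1 fun h => hv (hk' h)]
  · rwa [Finset.union_eq_left.2 hk]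
  · rwa [Finset.union_eq_left.2 hk']

lemma IsFan.star_cover (hF : IsFan F) {s : Finset V} (hs : s ∈ F) (v : V) :
    ∃ k : V →₀ ℝ, (∀ x ∉ s, 0 ≤ k x) ∧ s ∪ k.support ∈ F ∧ comb k = v := by
  choose c hc0 hcF hc using fun n : ℕ => hF.surj ((n : ℝ) • comb (ones s) + v)
  have : Finite F := hF.finite
  obtain ⟨⟨t, ht⟩, hinf⟩ := Finite.exists_infinite_fiber (fun n : ℕ => (⟨_, hcF n⟩ : F))
  set I : Set ℕ := (fun n : ℕ => (⟨_, hcF n⟩ : F)) ⁻¹' {⟨t, ht⟩} with hI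
  have hIinf : I.Infinite := Set.infinite_coe_iff.1 hinf
  have hsupp : ∀ n ∈ I, (c n).support = t := fun n hn => congrArg Subtype.val hn
  obtain ⟨n, hn⟩ := hIinf.nonempty
  obtain ⟨m, hm, hnm⟩ := hIinf.exists_gt n
  have hnm' : (0 : ℝ) < (m : ℝ) - n := by
    rw [sub_pos]; exact_mod_cast hnm
  set e : V →₀ ℝ := ((m : ℝ) - n)⁻¹ • (c m - c n) with he
  have hesupp : e.support ⊆ t := by
    refine (Finsupp.support_smul).trans ?_
    intro x hx
    rcases Finset.mem_union.1 (Finsupp.support_sub hx) with h | h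
    · rwa [hsupp m hm] at h
    · rwa [hsupp n hn] at h
  have hecomb : comb e = comb (ones s) := by
    simp only [he, map_smul, map_sub, hc]
    rw [add_sub_add_right_eq_sub, ← sub_smul, smul_smul, inv_mul_cancel₀ hnm'.ne', one_smul]
  have hline : ∀ l ∈ I, c l = c n + ((l : ℝ) - n) • e := by
    intro l hl
    apply hF.indep ht
    · rw [hsupp l hl]
    · refine Finsupp.support_add.trans (Finset.union_subset (hsupp n hn).le ?_)
      exact Finsupp.support_smul.trans hesupp
    · rw [map_add, map_smul, hecomb, hc, hc, sub_smul]; abel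
  have hepos : ∀ x, 0 ≤ e x := by
    intro x
    by_contra! hx
    obtain ⟨N, hN⟩ := exists_nat_gt ((n : ℝ) + c n x / (-e x))
    obtain ⟨l, hl, hlN⟩ := hIinf.exists_gt N
    have hlN' : (N : ℝ) < l := by exact_mod_cast hlN
    have h1 : c n x / (-e x) < (l : ℝ) - n := by linarith
    rw [div_lt_iff₀ (by linarith)] at h1
    have h2 := hc0 l x
    rw [hline l hl] at h2
    simp at h2
    nlinarith
  have hones : (ones s).support = s := by
    ext x; simp [ones_apply]
  have heq : e = ones s := hF.inj _ _ hepos (fun x => by rw [ones_apply]; split_ifs <;> simp)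
    (hF.down _ ht _ hesupp) (by rwa [hones]) hecomb
  have hst : s ⊆ t := by rw [← hones, ← heq]; exact hesupp
  refine ⟨c n - (n : ℝ) • ones s, fun x hx => ?_, hF.down _ ht _ ?_, ?_⟩
  · simpa [ones_apply, hx] using hc0 n x
  · refine Finset.union_subset hst fun x hx => ?_
    rcases Finset.mem_union.1 (Finsupp.support_sub hx) with h | h
    · rwa [hsupp n hn] at h
    · exact hst (hones ▸ Finsupp.support_smul h)
  · simp [hc]

lemma IsFan.linearIndepOn (hF : IsFan F) {s : Finset V} (hs : s ∈ F) :
    LinearIndepOn ℝ id (s : Set V) := by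
  rw [linearIndepOn_iff]
  intro l hl h0
  exact hF.indep hs (by simpa [Finsupp.mem_supported] using hl) (k' := 0) (by simp)
    (by simpa using h0)

/-- The facets of a fan are its cones of full dimension. -/
def Facet (F : Set (Finset V)) (τ : Finset V) : Prop := τ ∈ F ∧ τ.card = finrank ℝ V

variable [FiniteDimensional ℝ V]

lemma Facet.mem {τ : Finset V} (h : Facet F τ) : τ ∈ F := h.1

lemma IsFan.exists_facet (hF : IsFan F) {s : Finset V} (hs : s ∈ F) : ∃ τ, Facet F τ ∧ s ⊆ τ := by
  obtain ⟨τ, hsτ, hmax⟩ := hF.finite.exists_le_maximal hs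
  refine ⟨τ, ⟨hmax.prop, ?_⟩, hsτ⟩
  have hspan : Submodule.span ℝ (τ : Set V) = ⊤ := by
    rw [eq_top_iff]
    rintro v -
    obtain ⟨k, -, hk, rfl⟩ := hF.star_cover hmax.prop v
    have : τ ∪ k.support ⊆ τ := hmax.le_of_ge hk Finset.subset_union_left
    have h2 : k.support ⊆ τ := Finset.subset_union_right.trans this
    rw [← Set.image_id (τ : Set V), Finsupp.mem_span_image_iff_linearCombination]
    exact ⟨k, by simpa [Finsupp.mem_supported] using h2, rfl⟩
  have := finrank_span_finset_eq_card (hF.linearIndepOn hmax.prop)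
  rw [← this, hspan, finrank_top]

lemma IsFan.facet_span (hF : IsFan F) {τ : Finset V} (h : Facet F τ) (v : V) :
    ∃ k : V →₀ ℝ, k.support ⊆ τ ∧ comb k = v := by
  have hspan : Submodule.span ℝ (τ : Set V) = ⊤ := by
    apply Submodule.eq_top_of_finrank_eq
    rw [finrank_span_finset_eq_card (hF.linearIndepOn h.1), h.2]
  have hv : v ∈ Submodule.span ℝ (id '' (τ : Set V)) := by simp [hspan]
  rw [Finsupp.mem_span_image_iff_linearCombination] at hv
  obtain ⟨k, hk, hkv⟩ := hv
  exact ⟨k, by simpa [Finsupp.mem_supported] using hk, hkv⟩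

lemma Facet.eq_of_subset {τ : Finset V} (h : Facet F τ) (hF : IsFan F) {s : Finset V} (hs : s ∈ F)
    (hτ : τ ⊆ s) : s = τ := by
  obtain ⟨σ, hσ, hsσ⟩ := hF.exists_facet hs
  have : τ = σ := Finset.eq_of_subset_of_card_le (hτ.trans hsσ) (by rw [hσ.2, h.2])
  exact (this ▸ hsσ).antisymm hτ

/-- The coordinates of `p` with respect to `τ` (zero if there are none). -/
noncomputable def crd (τ : Finset V) (p : V) : V →₀ ℝ :=
  if h : ∃ k : V →₀ ℝ, k.support ⊆ τ ∧ comb k = p then h.choose else 0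

lemma crd_support (τ : Finset V) (p : V) : (crd τ p).support ⊆ τ := by
  unfold crd
  split_ifs with h
  · exact h.choose_spec.1
  · simp

lemma crd_eq_zero {τ : Finset V} {p v : V} (h : v ∉ τ) : crd τ p v = 0 :=
  Finsupp.notMem_support_iff.1 fun h' => h (crd_support τ p h')

lemma IsFan.comb_crd (hF : IsFan F) {τ : Finset V} (h : Facet F τ) (p : V) :
    comb (crd τ p) = p := by
  have := hF.facet_span h p
  unfold crd
  rw [dif_pos this]
  exact this.choose_spec.2

lemma IsFan.crd_eq (hF : IsFan F) {τ : Finset V} (h : Facet F τ) {p : V} {k : V →₀ ℝ}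
    (hk : k.support ⊆ τ) (hp : comb k = p) : crd τ p = k :=
  hF.indep h.1 (crd_support τ p) hk (by rw [hF.comb_crd h, hp])

lemma IsFan.crd_neg (hF : IsFan F) {τ : Finset V} (h : Facet F τ) (p : V) :
    crd τ (-p) = -crd τ p :=
  hF.crd_eq h (by rw [Finsupp.support_neg]; exact crd_support τ p)
    (by rw [map_neg, hF.comb_crd h])

end Fan

section Rank

variable {V : Type*} [NormedAddCommGroup V] [InnerProductSpace ℝ V] [DecidableEq V]
  [FiniteDimensional ℝ V] {F : Set (Finset V)}

/-- `τ'` contains the wall of `τ` opposite to `c` but not `c`. -/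
def Adj (τ τ' : Finset V) (c : V) : Prop := c ∈ τ ∧ c ∉ τ' ∧ τ.erase c ⊆ τ'

lemma IsFan.exists_adj (hF : IsFan F) {τ : Finset V} (hτ : Facet F τ) {c : V} (hc : c ∈ τ) :
    ∃ τ', Facet F τ' ∧ Adj τ τ' c := by
  obtain ⟨k, hk0, hkF, hk⟩ := hF.star_cover (hF.down _ hτ.1 _ (Finset.erase_subset c τ)) (-c)
  obtain ⟨τ', hτ', hsub⟩ := hF.exists_facet hkF
  have hs := Finset.union_subset_left hsub
  refine ⟨τ', hτ', hc, fun hcτ => ?_, hs⟩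
  have heq : τ ⊆ τ' := fun x hx => by
    by_cases hxc : x = c
    · exact hxc ▸ hcτ
    · exact hs (Finset.mem_erase.2 ⟨hxc, hx⟩)
  have h1 : k = -Finsupp.single c 1 := by
    refine hF.indep hτ'.1 (Finset.union_subset_right hsub) ?_ (by simp [hk])
    rw [Finsupp.support_neg]
    exact Finsupp.support_single_subset.trans (by simpa using hcτ)
  have := hk0 c (by simp)
  rw [h1] at this
  simp at this
  linarith

lemma Adj.exists_symm {τ τ' : Finset V} {c : V} (h : Adj τ τ' c) (hτ : Facet F τ)
    (hτ' : Facet F τ') : ∃ d, Adj τ' τ d ∧ τ'.erase d = τ.erase c := by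
  obtain ⟨hc, hc', hs⟩ := h
  have hcard : (τ' \ τ.erase c).card = 1 := by
    have h1 := Finset.card_erase_add_one hc
    have h2 := Finset.card_sdiff_add_card_eq_card hs
    have := hτ.2
    have := hτ'.2
    omega
  obtain ⟨d, hd⟩ := Finset.card_eq_one.1 hcard
  have hd' : d ∈ τ' \ τ.erase c := by simp [hd]
  rw [Finset.mem_sdiff] at hd'
  have hdc : d ≠ c := fun h => hc' (h ▸ hd'.1)
  have hdτ : d ∉ τ := fun h => hd'.2 (Finset.mem_erase.2 ⟨hdc, h⟩)
  have heq : τ'.erase d = τ.erase c := by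
    ext x
    constructor
    · intro hx
      rw [Finset.mem_erase] at hx
      by_contra hxs
      have : x ∈ τ' \ τ.erase c := Finset.mem_sdiff.2 ⟨hx.2, hxs⟩
      rw [hd, Finset.mem_singleton] at this
      exact hx.1 this
    · intro hx
      exact Finset.mem_erase.2 ⟨fun h => hd'.2 (h ▸ hx), hs hx⟩
  exact ⟨d, ⟨hd'.1, hdτ, heq ▸ Finset.erase_subset _ _⟩, heq⟩

lemma IsFan.adj_neg (hF : IsFan F) {τ τ' : Finset V} {c d p : V} (h : Adj τ τ' c)
    (h' : Adj τ' τ d) (hτ : Facet F τ) (hτ' : Facet F τ') (hc : 0 < crd τ p c) :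
    crd τ' p d < 0 := by
  by_contra! hd
  have hsub : τ.erase c ∪ (crd τ p).support ⊆ τ :=
    Finset.union_subset (Finset.erase_subset _ _) (crd_support _ _)
  have hsub' : τ.erase c ∪ (crd τ' p).support ⊆ τ' :=
    Finset.union_subset h.2.2 (crd_support _ _)
  have key : crd τ p = crd τ' p := by
    refine hF.star_unique (s := τ.erase c) (fun v hv => ?_) (fun v hv => ?_)
      (hF.down _ hτ.1 _ hsub) (hF.down _ hτ'.1 _ hsub') ?_
    · by_cases hvc : v = c
      · rw [hvc]; exact hc.le
      · rw [crd_eq_zero]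
        exact fun hvτ => hv (Finset.mem_erase.2 ⟨hvc, hvτ⟩)
    · by_cases hvd : v = d
      · rw [hvd]; exact hd
      · rw [crd_eq_zero]
        intro hvτ
        refine hv (Finset.mem_erase.2 ⟨fun hvc => h.2.1 (hvc ▸ hvτ), ?_⟩)
        exact h'.2.2 (Finset.mem_erase.2 ⟨hvd, hvτ⟩)
    · rw [hF.comb_crd hτ, hF.comb_crd hτ']
  rw [key, crd_eq_zero h.2.1] at hc
  exact lt_irrefl _ hc

lemma IsFan.adj_pos (hF : IsFan F) {τ τ' : Finset V} {c d p : V} (h : Adj τ τ' c)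
    (h' : Adj τ' τ d) (hτ : Facet F τ) (hτ' : Facet F τ') (hc : crd τ p c < 0) :
    0 < crd τ' p d := by
  have := hF.adj_neg (p := -p) h h' hτ hτ'
  rw [hF.crd_neg hτ, hF.crd_neg hτ'] at this
  simpa [hc] using this

/-- The function `r` strictly decreases whenever one crosses a wall satisfying `P` away from
`p`. -/
def Ranks (F : Set (Finset V)) (p : V) (P : Finset V → Prop) (r : Finset V → ℤ) : Prop :=
  ∀ τ τ', Facet F τ → Facet F τ' → ∀ c, Adj τ τ' c → P (τ.erase c) → 0 < crd τ p c → r τ' < r τ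

lemma Ranks.neg {p : V} {P : Finset V → Prop} {r : Finset V → ℤ} (hr : Ranks F p P r)
    (hF : IsFan F) : Ranks F (-p) P (-r) := by
  intro τ τ' hτ hτ' c h hP hc
  obtain ⟨d, h', he⟩ := h.exists_symm hτ hτ'
  rw [hF.crd_neg hτ] at hc
  have h1 : crd τ p c < 0 := by simpa using hc
  have h2 := hF.adj_pos h h' hτ hτ' h1
  have := hr τ' τ hτ' hτ d h' (he ▸ hP) h2
  simpa using this

lemma Ranks.lt_of_neg_subset {p : V} {P : Finset V → Prop} {r : Finset V → ℤ}
    (hr : Ranks F p P r) (hF : IsFan F) {s : Finset V} (hP : ∀ t, s ⊆ t → P t) {τ : Finset V}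
    (hτ : Facet F τ) (hsτ : s ⊆ τ) (hneg : ∀ c, crd τ p c < 0 → c ∈ s) {τ' : Finset V}
    (hτ' : Facet F τ') (hsτ' : s ⊆ τ') (hne : τ' ≠ τ)
    (hsupp : ∀ σ, Facet F σ → (crd σ p).support = σ) : r τ' < r τ := by
  have hfin : {σ | Facet F σ ∧ s ⊆ σ}.Finite := hF.finite.subset fun σ h => h.1.1
  have hmax : ∀ σ, Facet F σ → s ⊆ σ → (∀ ρ, Facet F ρ → s ⊆ ρ → r ρ ≤ r σ) → σ = τ := by
    intro σ hσ hsσ hm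
    have hnegσ : ∀ c, crd σ p c < 0 → c ∈ s := by
      intro c hc
      by_contra hcs
      have hcσ : c ∈ σ := by
        by_contra h
        rw [crd_eq_zero h] at hc
        exact lt_irrefl _ hc
      obtain ⟨ρ, hρ, had⟩ := hF.exists_adj hσ hcσ
      obtain ⟨d, had', he⟩ := had.exists_symm hσ hρ
      have hsw : s ⊆ σ.erase c := fun x hx =>
        Finset.mem_erase.2 ⟨fun h => hcs (h ▸ hx), hsσ hx⟩
      have h1 := hr ρ σ hρ hσ d had' (he ▸ hP _ hsw) (hF.adj_pos had had' hσ hρ hc)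
      exact absurd (hm ρ hρ (hsw.trans had.2.2)) (not_le.2 h1)
    have key : crd σ p = crd τ p := by
      refine hF.star_unique (s := s) (fun v hv => ?_) (fun v hv => ?_)
        (hF.down _ hσ.1 _ (Finset.union_subset hsσ (crd_support _ _)))
        (hF.down _ hτ.1 _ (Finset.union_subset hsτ (crd_support _ _))) ?_
      · by_contra! h; exact hv (hnegσ v h)
      · by_contra! h; exact hv (hneg v h)
      · rw [hF.comb_crd hτ, hF.comb_crd hσ]
    rw [← hsupp σ hσ, key, hsupp τ hτ]
  obtain ⟨μ, ⟨hμ, hsμ⟩, hμmax⟩ := Set.exists_max_image _ r hfin ⟨τ, hτ, hsτ⟩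
  have hμτ : μ = τ := hmax μ hμ hsμ fun ρ h1 h2 => hμmax ρ ⟨h1, h2⟩
  subst hμτ
  refine lt_of_le_of_ne (hμmax τ' ⟨hτ', hsτ'⟩) fun h => hne ?_
  exact hmax τ' hτ' hsτ' fun ρ h1 h2 => h ▸ hμmax ρ ⟨h1, h2⟩

lemma Ranks.lt_of_pos_subset {p : V} {P : Finset V → Prop} {r : Finset V → ℤ}
    (hr : Ranks F p P r) (hF : IsFan F) {s : Finset V} (hP : ∀ t, s ⊆ t → P t) {τ : Finset V}
    (hτ : Facet F τ) (hsτ : s ⊆ τ) (hpos : ∀ c, 0 < crd τ p c → c ∈ s) {τ' : Finset V}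
    (hτ' : Facet F τ') (hsτ' : s ⊆ τ') (hne : τ' ≠ τ)
    (hsupp : ∀ σ, Facet F σ → (crd σ p).support = σ) : r τ < r τ' := by
  have hs' : ∀ σ, Facet F σ → (crd σ (-p)).support = σ := fun σ hσ => by
    rw [hF.crd_neg hσ, Finsupp.support_neg, hsupp σ hσ]
  have := (hr.neg hF).lt_of_neg_subset hF hP hτ hsτ
    (fun c hc => hpos c (by rw [hF.crd_neg hτ] at hc; simpa using hc)) hτ' hsτ' hne
    hs'
  simpa using this

end Rank

section Flip

variable {V : Type*} [NormedAddCommGroup V] [InnerProductSpace ℝ V] [DecidableEq V]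
  {F G : Set (Finset V)}

/-- The result of replacing `A ⋆ ∂B ⋆ L` by `∂A ⋆ B ⋆ L`, where `∂B ⋆ L` is the link of `A`. -/
def flip (F : Set (Finset V)) (A B : Finset V) : Set (Finset V) :=
  {s | s ∈ F ∧ ¬A ⊆ s} ∪ {t | B ⊆ t ∧ ¬A ⊆ t ∧ t \ B ∪ A ∈ F}

lemma IsFan.notMem_of_circuit (hF : IsFan F) {z : V →₀ ℝ} (hz : comb z = 0) {A B : Finset V}
    (hA : ∀ v, v ∈ A ↔ 0 < z v) (hB : ∀ v, v ∈ B ↔ z v < 0) (hne : A.Nonempty) (hAF : A ∈ F) :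
    B ∉ F := by
  intro hBF
  have hdisj : ∀ v ∈ A, v ∉ B := fun v h h' => lt_asymm ((hA v).1 h) ((hB v).1 h')
  have key := hF.star_unique (s := ∅) (k := z.filter (· ∈ A)) (k' := -z.filter (· ∈ B))
    (fun v _ => ?_) (fun v _ => ?_) (hF.down _ hAF _ ?_) (hF.down _ hBF _ ?_) ?_
  · obtain ⟨a, ha⟩ := hne
    have := DFunLike.congr_fun key a
    have h2 := (hA a).1 ha
    simp [ha, hdisj a ha] at this
    linarith
  · by_cases h : v ∈ A
    · simpa [h] using ((hA v).1 h).le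
    · simp [h]
  · by_cases h : v ∈ B
    · simpa [h] using ((hB v).1 h).le
    · simp [h]
  · intro v hv
    simp at hv; exact hv.2
  · intro v hv
    simp at hv; exact hv.2
  · have : z = z.filter (· ∈ A) + z.filter (· ∈ B) := by
      ext v
      by_cases h : v ∈ A
      · simp [h, hdisj v h]
      · by_cases h' : v ∈ B
        · simp [h, h']
        · have h1 := mt (hA v).2 h
          have h2 := mt (hB v).2 h'
          simp [h, h']; linarith
    rw [map_neg, eq_neg_iff_add_eq_zero, ← map_add, ← this, hz]

lemma IsFan.flip (hF : IsFan F) {z : V →₀ ℝ} (hz : comb z = 0) {A B : Finset V}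
    (hA : ∀ v, v ∈ A ↔ 0 < z v) (hB : ∀ v, v ∈ B ↔ z v < 0) (hAne : A.Nonempty)
    (hBne : B.Nonempty) (hAF : A ∈ F) (hunit : ∀ b ∈ B, ‖b‖ = 1)
    (hlink : ∀ s ∈ F, A ⊆ s → ∀ T ⊂ B, s \ B ∪ T ∈ F) : IsFan (flip F A B) := by
  have hBF := hF.notMem_of_circuit hz hA hB hAne hAF
  have hdisj : ∀ v ∈ A, v ∉ B := fun v h h' => lt_asymm ((hA v).1 h) ((hB v).1 h')
  have hback : ∀ c : V →₀ ℝ, (∀ v, 0 ≤ c v) → c.support ∈ SphFan.flip F A B →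
      ∃ u : ℝ, (∀ v, 0 ≤ (c + u • z) v) ∧ (c + u • z).support ∈ F := by
    rintro c hc (⟨h1, -⟩ | ⟨h1, h2, h3⟩)
    · exact ⟨0, by simpa using hc, by simpa using h1⟩
    · obtain ⟨b, hb, hmin⟩ := B.exists_min_image (fun b => c b / (-z b)) hBne
      have hzb := (hB b).1 hb
      have hu : 0 ≤ c b / (-z b) := div_nonneg (hc b) (by linarith)
      refine ⟨c b / (-z b), fun v => ?_, hF.down _ (hlink _ h3 Finset.subset_union_right
        (B.erase b) (Finset.erase_ssubset hb)) _ fun v hv => ?_⟩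
      · by_cases hv : v ∈ B
        · have h4 := hmin v hv
          have hzv := (hB v).1 hv
          rw [le_div_iff₀ (by linarith)] at h4
          simp only [Finsupp.add_apply, Finsupp.smul_apply, smul_eq_mul]
          linarith
        · have hzv := not_lt.1 (mt (hB v).2 hv)
          have := hc v
          simp only [Finsupp.add_apply, Finsupp.smul_apply, smul_eq_mul]
          positivity
      · have hvb : v ≠ b := by
          rintro rfl
          rw [Finsupp.mem_support_iff] at hv
          apply hv
          have hz0 : z v ≠ 0 := hzb.ne
          simp only [Finsupp.add_apply, Finsupp.smul_apply, smul_eq_mul]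
          rw [div_neg, neg_mul, div_mul_cancel₀ _ hz0, add_neg_cancel]
        by_cases hvB : v ∈ B
        · exact Finset.mem_union_right _ (Finset.mem_erase.2 ⟨hvb, hvB⟩)
        · refine Finset.mem_union_left _ (Finset.mem_sdiff.2 ⟨?_, hvB⟩)
          rcases Finset.mem_union.1 (Finsupp.support_add hv) with h | h
          · exact Finset.mem_union_left _ (Finset.mem_sdiff.2 ⟨h, hvB⟩)
          · apply Finset.mem_union_right
            have h5 := Finsupp.mem_support_iff.1 (Finsupp.support_smul h)
            have hzv := not_lt.1 (mt (hB v).2 hvB)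
            exact (hA v).2 (lt_of_le_of_ne hzv h5.symm)
  have hnotA : ∀ s ∈ SphFan.flip F A B, ¬A ⊆ s := by
    rintro s (⟨-, h⟩ | ⟨-, h, -⟩) <;> exact h
  have hle : ∀ (c d : V →₀ ℝ) (u u' : ℝ), (∀ v, 0 ≤ d v) → ¬A ⊆ c.support →
      c + u • z = d + u' • z → u' ≤ u := by
    intro c d u u' hd hcA h
    by_contra! hlt
    refine hcA fun a ha => ?_
    have hza := (hA a).1 ha
    have h1 := DFunLike.congr_fun h a
    simp only [Finsupp.add_apply, Finsupp.smul_apply, smul_eq_mul] at h1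
    have h2 := hd a
    rw [Finsupp.mem_support_iff]
    nlinarith [mul_pos (sub_pos.2 hlt) hza]
  refine ⟨?_, Or.inl ⟨hF.empty_mem, fun h => ?_⟩, ?_, ?_, ?_, ?_⟩
  · refine (hF.finite.union (hF.finite.image (· ∪ B))).subset ?_
    rintro s (⟨h, -⟩ | ⟨h1, -, h3⟩)
    · exact Or.inl h
    · exact Or.inr ⟨s \ B, hF.down _ h3 _ Finset.subset_union_left,
        Finset.sdiff_union_of_subset h1⟩
  · exact hAne.ne_empty (Finset.subset_empty.1 h)
  · rintro s (⟨h, h'⟩ | ⟨h1, h2, h3⟩) t hts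
    · exact Or.inl ⟨hF.down _ h _ hts, fun h'' => h' (h''.trans hts)⟩
    · have hAt : ¬A ⊆ t := fun h => h2 (h.trans hts)
      by_cases hBt : B ⊆ t
      · exact Or.inr ⟨hBt, hAt, hF.down _ h3 _
          (Finset.union_subset_union_left (Finset.sdiff_subset_sdiff hts le_rfl))⟩
      · refine Or.inl ⟨?_, hAt⟩
        have hT : t ∩ B ⊂ B := by
          refine ⟨Finset.inter_subset_right, fun h => hBt (h.trans Finset.inter_subset_left)⟩
        refine hF.down _ (hlink _ h3 Finset.subset_union_right _ hT) _ fun v hv => ?_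
        by_cases hvB : v ∈ B
        · simp [hv, hvB]
        · simp [hvB, hts hv]
  · rintro s (⟨h, -⟩ | ⟨h1, -, h3⟩) v hv
    · exact hF.unit _ h v hv
    · by_cases hvB : v ∈ B
      · exact hunit v hvB
      · exact hF.unit _ h3 v (by simp [hv, hvB])
  · intro c d hc hd hcF hdF h
    obtain ⟨u, hu0, huF⟩ := hback c hc hcF
    obtain ⟨u', hu0', huF'⟩ := hback d hd hdF
    have key := hF.inj _ _ hu0 hu0' huF huF' (by simp only [map_add, map_smul, hz, h, smul_zero])
    have : u = u' := le_antisymm (hle d c u' u hc (hnotA _ hdF) key.symm)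
      (hle c d u u' hd (hnotA _ hcF) key)
    rw [this] at key
    exact add_right_cancel key
  · intro x
    obtain ⟨c, hc, hcF, hcx⟩ := hF.surj x
    by_cases hAc : A ⊆ c.support
    · obtain ⟨a, ha, hmin⟩ := A.exists_min_image (fun a => c a / z a) hAne
      have hza := (hA a).1 ha
      have hca : 0 < c a := lt_of_le_of_ne (hc a) (Finsupp.mem_support_iff.1 (hAc ha)).symm
      have hu : 0 < c a / z a := div_pos hca hza
      set u := c a / z a with hudef
      refine ⟨c - u • z, fun v => ?_, Or.inr ⟨fun b hb => ?_, fun h => ?_, ?_⟩, by simp [hz, hcx]⟩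
      · simp only [Finsupp.sub_apply, Finsupp.smul_apply, smul_eq_mul]
        by_cases hv : v ∈ A
        · have h4 := hmin v hv
          rw [le_div_iff₀ ((hA v).1 hv)] at h4
          linarith
        · have := not_lt.1 (mt (hA v).2 hv)
          have := hc v
          nlinarith
      · have := (hB b).1 hb
        have := hc b
        rw [Finsupp.mem_support_iff]
        simp only [Finsupp.sub_apply, Finsupp.smul_apply, smul_eq_mul]
        nlinarith
      · have := Finsupp.mem_support_iff.1 (h ha)
        apply this
        simp only [Finsupp.sub_apply, Finsupp.smul_apply, smul_eq_mul, hudef]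
        field_simp
        ring
      · refine hF.down _ hcF _ (Finset.union_subset (fun v hv => ?_) hAc)
        rw [Finset.mem_sdiff] at hv
        rcases Finset.mem_union.1 (Finsupp.support_sub hv.1) with h | h
        · exact h
        · have h5 := Finsupp.mem_support_iff.1 (Finsupp.support_smul h)
          have hzv := not_lt.1 (mt (hB v).2 hv.2)
          exact hAc ((hA v).2 (lt_of_le_of_ne hzv h5.symm))
    · exact ⟨c, hc, Or.inl ⟨hcF, hAc⟩, hcx⟩

/-- A bistellar move replacing `A ⋆ ∂B` by `∂A ⋆ B`. -/
def Move (F G : Set (Finset V)) : Prop :=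
  ∃ A B : Finset V, A ∈ F ∧ A.Nonempty ∧ B.Nonempty ∧ B ∉ F ∧ Disjoint A B ∧
    A.card + B.card = finrank ℝ V + 1 ∧ (∀ s, A ⊆ s → (s ∈ F ↔ s ⊆ A ∪ B ∧ ¬B ⊆ s)) ∧
    G = {s | s ∈ F ∧ ¬A ⊆ s} ∪ {t | B ⊆ t ∧ t ⊆ A ∪ B ∧ ¬A ⊆ t}

/-- Two fans are linked if they are related by bistellar moves and their inverses. -/
def Linked (F G : Set (Finset V)) : Prop :=
  ∃ (hF : IsFan F) (hG : IsFan G),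
    Relation.EqvGen (fun a b : {F : Set (Finset V) // IsFan F} => Move a.1 b.1) ⟨F, hF⟩ ⟨G, hG⟩

lemma Linked.refl (hF : IsFan F) : Linked F F := ⟨hF, hF, .refl _⟩

lemma Linked.symm (h : Linked F G) : Linked G F := by
  obtain ⟨hF, hG, h⟩ := h
  exact ⟨hG, hF, h.symm⟩

lemma Linked.trans {H : Set (Finset V)} (h : Linked F G) (h' : Linked G H) : Linked F H := by
  obtain ⟨hF, hG, h⟩ := h
  obtain ⟨hG, hH, h'⟩ := h'
  exact ⟨hF, hH, h.trans _ _ _ h'⟩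

lemma Linked.isFan_right (h : Linked F G) : IsFan G := h.2.1

lemma linked_of_circuit (hF : IsFan F) {z : V →₀ ℝ} (hz : comb z = 0) {A B : Finset V}
    (hA : ∀ v, v ∈ A ↔ 0 < z v) (hB : ∀ v, v ∈ B ↔ z v < 0) (hAne : A.Nonempty)
    (hBne : B.Nonempty) (hcard : A.card + B.card = finrank ℝ V + 1) (hunit : ∀ b ∈ B, ‖b‖ = 1)
    (hlink : ∀ s, A ⊆ s → (s ∈ F ↔ s ⊆ A ∪ B ∧ ¬B ⊆ s)) :
    Linked F ({s | s ∈ F ∧ ¬A ⊆ s} ∪ {t | B ⊆ t ∧ t ⊆ A ∪ B ∧ ¬A ⊆ t}) := by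
  have hdisj : Disjoint A B := Finset.disjoint_left.2
    fun v h h' => lt_asymm ((hA v).1 h) ((hB v).1 h')
  have hBA : ¬B ⊆ A := fun h => by
    obtain ⟨b, hb⟩ := hBne
    exact Finset.disjoint_left.1 hdisj (h hb) hb
  have hAF : A ∈ F := (hlink A le_rfl).2 ⟨Finset.subset_union_left, hBA⟩
  have hfan := hF.flip hz hA hB hAne hBne hAF hunit fun s hs hAs T hT => by
    have hAsT : A ⊆ s \ B ∪ T := fun a ha => Finset.mem_union_left _
      (Finset.mem_sdiff.2 ⟨hAs ha, Finset.disjoint_left.1 hdisj ha⟩)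
    refine (hlink _ hAsT).2 ⟨Finset.union_subset ?_ (hT.1.trans Finset.subset_union_right), ?_⟩
    · exact Finset.sdiff_subset.trans ((hlink s hAs).1 hs).1
    · intro h
      refine hT.2 fun b hb => ?_
      rcases Finset.mem_union.1 (h hb) with h1 | h1
      · exact absurd hb (Finset.mem_sdiff.1 h1).2
      · exact h1
  have heq : SphFan.flip F A B =
      {s | s ∈ F ∧ ¬A ⊆ s} ∪ {t | B ⊆ t ∧ t ⊆ A ∪ B ∧ ¬A ⊆ t} := by
    unfold SphFan.flip
    congr 1
    ext t
    simp only [Set.mem_ofPred_eq]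
    constructor
    · rintro ⟨h1, h2, h3⟩
      refine ⟨h1, fun v hv => ?_, h2⟩
      by_cases hvB : v ∈ B
      · exact Finset.mem_union_right _ hvB
      · exact ((hlink _ Finset.subset_union_right).1 h3).1 (by simp [hv, hvB])
    · rintro ⟨h1, h2, h3⟩
      refine ⟨h1, h3, (hlink _ Finset.subset_union_right).2 ⟨?_, ?_⟩⟩
      · exact Finset.union_subset (Finset.sdiff_subset.trans h2) Finset.subset_union_left
      · intro h
        obtain ⟨b, hb⟩ := hBne
        rcases Finset.mem_union.1 (h hb) with h4 | h4
        · exact (Finset.mem_sdiff.1 h4).2 hb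
        · exact Finset.disjoint_left.1 hdisj h4 hb
  rw [heq] at hfan
  exact ⟨hF, hfan, .rel _ _ ⟨A, B, hAF, hAne, hBne, hF.notMem_of_circuit hz hA hB hAne hAF,
    hdisj, hcard, hlink, rfl⟩⟩

end Flip

section Cone

variable {V : Type*} [NormedAddCommGroup V] [InnerProductSpace ℝ V] [DecidableEq V]
  [FiniteDimensional ℝ V] {F : Set (Finset V)}

/-- The elements of `τ` at which the coordinate of `p` is positive. -/
noncomputable def posPart (τ : Finset V) (p : V) : Finset V := {c ∈ τ | 0 < crd τ p c}

/-- The elements of `τ` at which the coordinate of `p` is negative. -/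
noncomputable def negPart (τ : Finset V) (p : V) : Finset V := {c ∈ τ | crd τ p c < 0}

lemma mem_posPart {τ : Finset V} {p v : V} : v ∈ posPart τ p ↔ 0 < crd τ p v := by
  simp only [posPart, Finset.mem_filter, and_iff_right_iff_imp]
  intro h
  by_contra hv
  rw [crd_eq_zero hv] at h
  exact lt_irrefl _ h

lemma mem_negPart {τ : Finset V} {p v : V} : v ∈ negPart τ p ↔ crd τ p v < 0 := by
  simp only [negPart, Finset.mem_filter, and_iff_right_iff_imp]
  intro h
  by_contra hv
  rw [crd_eq_zero hv] at h
  exact lt_irrefl _ h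

/-- The vector `p` lies on no hyperplane spanned by a wall of the fan. -/
def Generic (F : Set (Finset V)) (p : V) : Prop := ∀ τ, Facet F τ → (crd τ p).support = τ

/-- The complex obtained by replacing the cones in `D` by the cones from `p` over the common
boundary of `D` and its complement. -/
def coned (F : Set (Finset V)) (p : V) (D : Set (Finset V)) : Set (Finset V) :=
  {s | p ∉ s ∧ ∃ τ, Facet F τ ∧ τ ∉ D ∧ s ⊆ τ} ∪
  {t | p ∈ t ∧ (∃ τ, Facet F τ ∧ τ ∈ D ∧ t.erase p ⊆ τ) ∧ ∃ τ, Facet F τ ∧ τ ∉ D ∧ t.erase p ⊆ τ}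

lemma Generic.notMem {p : V} (hp : Generic F p) (hF : IsFan F) (hd : 1 < finrank ℝ V)
    {s : Finset V} (hs : s ∈ F) : p ∉ s := by
  intro hps
  obtain ⟨τ, hτ, hsτ⟩ := hF.exists_facet hs
  have h1 : crd τ p = Finsupp.single p 1 := hF.crd_eq hτ
    (Finsupp.support_single_subset.trans (by simpa using hsτ hps)) (by simp)
  have h2 := hp τ hτ
  rw [h1, Finsupp.support_single _ one_ne_zero] at h2
  have := hτ.2
  rw [← h2, Finset.card_singleton] at this
  omega

lemma coned_empty (hF : IsFan F) {p : V} (hp : Generic F p) (hd : 1 < finrank ℝ V) :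
    coned F p ∅ = F := by
  ext s
  simp only [coned, Set.mem_union, Set.mem_ofPred_eq, Set.mem_empty_iff_false, not_false_eq_true,
    true_and, false_and, and_false, exists_false, or_false]
  constructor
  · rintro ⟨-, τ, hτ, h⟩
    exact hF.down _ hτ.1 _ h
  · intro h
    exact ⟨hp.notMem hF hd h, hF.exists_facet h⟩

/-- The facets containing `A` other than one with `-p` in its interior. -/
def coneRegion (F : Set (Finset V)) (p : V) (A : Finset V) : Set (Finset V) :=
  {σ | Facet F σ ∧ A ⊆ σ ∧ ∃ c, 0 < crd σ p c}

lemma linked_coned_insert (hF : IsFan F) {p : V} (hp : Generic F p) (hp1 : ‖p‖ = 1)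
    (hd : 1 < finrank ℝ V) {P : Finset V → Prop} {r : Finset V → ℤ} (hr : Ranks F p P r)
    {A : Finset V} (hAP : ∀ t, A ⊆ t → P t)
    (hA : ∀ σ, Facet F σ → A ⊆ σ → ∀ a ∈ A, 0 < crd σ p a)
    {D : Set (Finset V)} (hDS : D ⊆ coneRegion F p A) (hfan : IsFan (coned F p D))
    {τ : Finset V} (hτS : τ ∈ coneRegion F p A) (hτD : τ ∉ D)
    (hup : ∀ σ ∈ coneRegion F p A, r τ < r σ → σ ∈ D) (hdown : ∀ σ ∈ D, r τ ≤ r σ) :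
    Linked (coned F p D) (coned F p (insert τ D)) := by
  obtain ⟨hτ, hAτ, c₀, hc₀⟩ := hτS
  have hApos : A ⊆ posPart τ p := fun a ha => mem_posPart.2 (hA τ hτ hAτ a ha)
  have hposτ : posPart τ p ⊆ τ := Finset.filter_subset _ _
  have hnegτ : negPart τ p ⊆ τ := Finset.filter_subset _ _
  have hcover : ∀ v ∈ τ, v ∈ posPart τ p ∨ v ∈ negPart τ p := by
    intro v hv
    rw [mem_posPart, mem_negPart]
    rw [← hp τ hτ, Finsupp.mem_support_iff] at hv
    exact hv.lt_or_gt.symm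
  have hpτ : p ∉ τ := hp.notMem hF hd hτ.1
  have hstar_pos : ∀ σ, Facet F σ → posPart τ p ⊆ σ → σ ≠ τ → σ ∈ D := by
    intro σ hσ hsub hne
    have hlt := hr.lt_of_pos_subset hF (s := posPart τ p) (fun t ht => hAP t (hApos.trans ht)) hτ
      hposτ (fun c => mem_posPart.2) hσ hsub hne hp
    refine hup σ ⟨hσ, hApos.trans hsub, ?_⟩ hlt
    by_contra! hall
    have := hr.lt_of_pos_subset hF (s := A) hAP hσ (hApos.trans hsub)
      (fun c hc => absurd (hall c) (not_le.2 hc)) hτ hAτ hne.symm hp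
    exact lt_asymm this hlt
  have hstar_neg : ∀ σ, negPart τ p ⊆ σ → σ ≠ τ → σ ∉ D := by
    intro σ hsub hne hσD
    obtain ⟨hσ, hAσ, -⟩ := hDS hσD
    have := hr.lt_of_neg_subset hF (s := negPart τ p ∪ A)
      (fun t ht => hAP t (Finset.union_subset_right ht)) hτ (Finset.union_subset hnegτ hAτ)
      (fun c hc => Finset.mem_union_left _ (mem_negPart.2 hc)) hσ (Finset.union_subset hsub hAσ)
      hne hp
    exact absurd (hdown σ hσD) (not_le.2 this)
  have hlater : ∀ s, s ⊆ τ → ¬posPart τ p ⊆ s → ∃ σ, Facet F σ ∧ σ ∉ D ∧ σ ≠ τ ∧ s ⊆ σ := by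
    intro s hs hns
    obtain ⟨c, hc, hcs⟩ := Finset.not_subset.1 hns
    obtain ⟨σ, hσ, had⟩ := hF.exists_adj hτ (hposτ hc)
    have hne : σ ≠ τ := fun h => had.2.1 (h ▸ had.1)
    refine ⟨σ, hσ, fun hσD => ?_, hne, ?_⟩
    · obtain ⟨-, hAσ, -⟩ := hDS hσD
      have hAw : A ⊆ τ.erase c := fun a ha =>
        Finset.mem_erase.2 ⟨fun h => had.2.1 (h ▸ hAσ ha), hAτ ha⟩
      have := hr τ σ hτ hσ c had (hAP _ hAw) (mem_posPart.1 hc)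
      exact absurd (hdown σ hσD) (not_le.2 this)
    · exact fun x hx => had.2.2 (Finset.mem_erase.2 ⟨fun h => hcs (h ▸ hx), hs hx⟩)
  have hearlier : ∀ s, s ⊆ τ → ¬negPart τ p ⊆ s → ∃ σ, Facet F σ ∧ σ ∈ D ∧ s ⊆ σ := by
    intro s hs hns
    obtain ⟨c, hc, hcs⟩ := Finset.not_subset.1 hns
    obtain ⟨σ, hσ, had⟩ := hF.exists_adj hτ (hnegτ hc)
    obtain ⟨d, had', he⟩ := had.exists_symm hτ hσ
    have hpos := hF.adj_pos had had' hτ hσ (mem_negPart.1 hc)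
    have hAw : A ⊆ τ.erase c := fun a ha =>
      Finset.mem_erase.2 ⟨fun h => by
        have h1 := hA τ hτ hAτ a ha
        have h2 := mem_negPart.1 hc
        rw [h] at h1
        exact lt_asymm h1 h2, hAτ ha⟩
    have hlt := hr σ τ hσ hτ d had' (he ▸ hAP _ hAw) hpos
    refine ⟨σ, hσ, hup σ ⟨hσ, hAw.trans had.2.2, d, hpos⟩ hlt, ?_⟩
    exact fun x hx => had.2.2 (Finset.mem_erase.2 ⟨fun h => hcs (h ▸ hx), hs hx⟩)
  have hpneg : p ∉ negPart τ p := fun h => hpτ (hnegτ h)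
  have hppos : p ∉ posPart τ p := fun h => hpτ (hposτ h)
  have hunion : posPart τ p ∪ insert p (negPart τ p) = insert p τ := by
    ext v
    simp only [Finset.mem_union, Finset.mem_insert]
    constructor
    · rintro (h | rfl | h)
      exacts [Or.inr (hposτ h), Or.inl rfl, Or.inr (hnegτ h)]
    · rintro (rfl | h)
      · exact Or.inr (Or.inl rfl)
      · exact (hcover v h).imp_right Or.inr
  have hsub_insert : ∀ {t : Finset V}, t ⊆ insert p τ ↔ t.erase p ⊆ τ := by
    intro t; exact Finset.subset_insert_iff
  have hneg_insert : ∀ {t : Finset V}, p ∈ t →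
      (insert p (negPart τ p) ⊆ t ↔ negPart τ p ⊆ t.erase p) := by
    intro t ht
    rw [Finset.insert_subset_iff, Finset.subset_erase]
    tauto
  have hpos_erase : ∀ {t : Finset V}, posPart τ p ⊆ t ↔ posPart τ p ⊆ t.erase p := by
    intro t
    rw [Finset.subset_erase]; tauto
  have hlink : ∀ s, posPart τ p ⊆ s → (s ∈ coned F p D ↔
      s ⊆ posPart τ p ∪ insert p (negPart τ p) ∧ ¬insert p (negPart τ p) ⊆ s) := by
    intro s hs
    rw [hunion]
    by_cases hps : p ∈ s
    · rw [hsub_insert, hneg_insert hps]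
      constructor
      · rintro (⟨h, -⟩ | ⟨-, ⟨τ₁, -, hτ₁D, hs₁⟩, τ₂, hτ₂, hτ₂D, hs₂⟩)
        · exact absurd hps h
        · have : τ₂ = τ := by
            by_contra hne
            exact hτ₂D (hstar_pos τ₂ hτ₂ ((hpos_erase.1 hs).trans hs₂) hne)
          subst this
          exact ⟨hs₂, fun h => hstar_neg τ₁ (h.trans hs₁) (fun h => hτD (h ▸ hτ₁D)) hτ₁D⟩
      · rintro ⟨h1, h2⟩
        exact Or.inr ⟨hps, hearlier _ h1 h2, τ, hτ, hτD, h1⟩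
    · constructor
      · rintro (⟨-, σ, hσ, hσD, hsσ⟩ | ⟨h, -⟩)
        · have : σ = τ := by
            by_contra hne
            exact hσD (hstar_pos σ hσ (hs.trans hsσ) hne)
          subst this
          exact ⟨hsσ.trans (Finset.subset_insert _ _), fun h => hps (h (Finset.mem_insert_self _ _))⟩
        · exact absurd h hps
      · rintro ⟨h, -⟩
        rw [Finset.subset_insert_iff_of_notMem hps] at h
        exact Or.inl ⟨hps, τ, hτ, hτD, h⟩
  have heq : coned F p (insert τ D) = {s | s ∈ coned F p D ∧ ¬posPart τ p ⊆ s} ∪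
      {t | insert p (negPart τ p) ⊆ t ∧ t ⊆ posPart τ p ∪ insert p (negPart τ p) ∧
        ¬posPart τ p ⊆ t} := by
    rw [hunion]
    have hfirst : ∀ s, (∃ σ, Facet F σ ∧ σ ∉ insert τ D ∧ s ⊆ σ) ↔
        (∃ σ, Facet F σ ∧ σ ∉ D ∧ s ⊆ σ) ∧ ¬posPart τ p ⊆ s := by
      intro s
      constructor
      · rintro ⟨σ, hσ, hσD, hsσ⟩
        rw [Set.mem_insert_iff, not_or] at hσD
        exact ⟨⟨σ, hσ, hσD.2, hsσ⟩, fun h => hσD.2 (hstar_pos σ hσ (h.trans hsσ) hσD.1)⟩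
      · rintro ⟨⟨σ, hσ, hσD, hsσ⟩, hns⟩
        by_cases hστ : σ = τ
        · subst hστ
          obtain ⟨ρ, hρ, hρD, hne, hs⟩ := hlater s hsσ hns
          exact ⟨ρ, hρ, by simp [hne, hρD], hs⟩
        · exact ⟨σ, hσ, by simp [hστ, hσD], hsσ⟩
    ext t
    by_cases hpt : p ∈ t
    · simp only [coned, Set.mem_union, Set.mem_ofPred_eq, hpt, not_true_eq_false, false_and,
        true_and, false_or, hfirst, hsub_insert, hneg_insert hpt]
      rw [← hpos_erase]
      constructor
      · rintro ⟨⟨τ₁, hτ₁, hτ₁D, h₁⟩, h₂, h₃⟩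
        by_cases hex : ∃ σ, Facet F σ ∧ σ ∈ D ∧ t.erase p ⊆ σ
        · exact Or.inl ⟨⟨hex, h₂⟩, h₃⟩
        · rcases hτ₁D with rfl | hτ₁D
          · refine Or.inr ⟨?_, h₁, h₃⟩
            by_contra hns
            exact hex (hearlier _ h₁ hns)
          · exact absurd ⟨τ₁, hτ₁, hτ₁D, h₁⟩ hex
      · rintro (⟨⟨⟨σ, hσ, hσD, hs⟩, h₂⟩, h₃⟩ | ⟨h₁, h₂, h₃⟩)
        · exact ⟨⟨σ, hσ, Or.inr hσD, hs⟩, h₂, h₃⟩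
        · exact ⟨⟨τ, hτ, Or.inl rfl, h₂⟩, ⟨τ, hτ, hτD, h₂⟩, h₃⟩
    · have hins : ¬insert p (negPart τ p) ⊆ t := fun h => hpt (h (Finset.mem_insert_self _ _))
      simp only [coned, Set.mem_union, Set.mem_ofPred_eq, hpt, not_false_eq_true, false_and,
        true_and, or_false, hfirst, hins]
  rw [heq]
  refine linked_of_circuit hfan (z := crd τ p - Finsupp.single p 1) ?_ ?_ ?_ ?_ ?_ ?_ ?_ hlink
  · simp [hF.comb_crd hτ]
  · intro v
    by_cases hv : v = p
    · subst hv
      simp [hppos, crd_eq_zero hpτ]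
    · simp [mem_posPart, Ne.symm hv]
  · intro v
    by_cases hv : v = p
    · subst hv
      simp [crd_eq_zero hpτ]
    · simp [mem_negPart, hv]
  · exact ⟨c₀, mem_posPart.2 hc₀⟩
  · exact Finset.insert_nonempty _ _
  · rw [← Finset.card_union_of_disjoint, hunion, Finset.card_insert_of_notMem hpτ, hτ.2]
    rw [Finset.disjoint_left]
    intro v hv hv'
    rcases Finset.mem_insert.1 hv' with rfl | h
    · exact hppos hv
    · exact lt_asymm (mem_posPart.1 hv) (mem_negPart.1 h)
  · intro b hb
    rcases Finset.mem_insert.1 hb with rfl | h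
    · exact hp1
    · exact hF.unit _ hτ.1 b (hnegτ h)

lemma linked_coned (hF : IsFan F) {p : V} (hp : Generic F p) (hp1 : ‖p‖ = 1)
    (hd : 1 < finrank ℝ V) {P : Finset V → Prop} {r : Finset V → ℤ} (hr : Ranks F p P r)
    {A : Finset V} (hAP : ∀ t, A ⊆ t → P t)
    (hA : ∀ σ, Facet F σ → A ⊆ σ → ∀ a ∈ A, 0 < crd σ p a) :
    Linked F (coned F p (coneRegion F p A)) := by
  have hfin : (coneRegion F p A).Finite := hF.finite.subset fun σ h => h.1.1
  have key : ∀ (n : ℕ) (D : Set (Finset V)), D ⊆ coneRegion F p A →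
      (coneRegion F p A \ D).ncard = n → (∀ x ∈ D, ∀ y ∈ coneRegion F p A, r x < r y → y ∈ D) →
      IsFan (coned F p D) → Linked (coned F p D) (coned F p (coneRegion F p A)) := by
    intro n
    induction n with
    | zero =>
      intro D hD hn _ hfan
      rw [Set.ncard_eq_zero (hfin.subset Set.sdiff_subset), Set.sdiff_eq_empty] at hn
      rw [hD.antisymm hn]
      exact Linked.refl (hD.antisymm hn ▸ hfan)
    | succ n ih =>
      intro D hD hn hup hfan
      have hne : (coneRegion F p A \ D).Nonempty := by
        rw [← Set.ncard_pos (hfin.subset Set.sdiff_subset)]; omega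
      obtain ⟨τ, hτ, hmax⟩ := Set.exists_max_image _ r (hfin.subset Set.sdiff_subset) hne
      have hup' : ∀ σ ∈ coneRegion F p A, r τ < r σ → σ ∈ D := by
        intro σ hσ hlt
        by_contra h
        exact absurd (hmax σ ⟨hσ, h⟩) (not_le.2 hlt)
      have hdown : ∀ σ ∈ D, r τ ≤ r σ := by
        intro σ hσ
        by_contra! h
        exact hτ.2 (hup σ hσ τ hτ.1 h)
      have hl := linked_coned_insert hF hp hp1 hd hr hAP hA hD hfan hτ.1 hτ.2 hup' hdown
      refine hl.trans (ih _ (Set.insert_subset hτ.1 hD) ?_ ?_ hl.isFan_right)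
      · have h1 : coneRegion F p A \ insert τ D = (coneRegion F p A \ D) \ {τ} := by
          ext x; simp only [Set.mem_sdiff, Set.mem_insert_iff, Set.mem_singleton_iff]; tauto
        rw [h1, Set.ncard_sdiff_singleton_of_mem hτ, hn]
        rfl
      · rintro x (rfl | hx) y hy hlt
        · exact Or.inr (hup' y hy hlt)
        · exact Or.inr (hup x hx y hy hlt)
  have h0 := key _ ∅ (Set.empty_subset _) rfl (by simp) (by rwa [coned_empty hF hp hd])
  rwa [coned_empty hF hp hd] at h0

end Cone

section Generic

variable {V : Type*} [NormedAddCommGroup V] [InnerProductSpace ℝ V] [DecidableEq V]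
  [FiniteDimensional ℝ V] {F : Set (Finset V)}

lemma IsFan.crd_add (hF : IsFan F) {τ : Finset V} (h : Facet F τ) (p q : V) :
    crd τ (p + q) = crd τ p + crd τ q :=
  hF.crd_eq h (Finsupp.support_add.trans
    (Finset.union_subset (crd_support τ p) (crd_support τ q)))
    (by rw [map_add, hF.comb_crd h, hF.comb_crd h])

lemma IsFan.crd_smul (hF : IsFan F) {τ : Finset V} (h : Facet F τ) (t : ℝ) (p : V) :
    crd τ (t • p) = t • crd τ p :=
  hF.crd_eq h (Finsupp.support_smul.trans (crd_support τ p))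
    (by rw [map_smul, hF.comb_crd h])

/-- The coordinate at `v` with respect to a facet, as a linear functional. -/
lemma IsFan.exists_crd (hF : IsFan F) {τ : Finset V} (h : Facet F τ) (v : V) :
    ∃ f : V →ₗ[ℝ] ℝ, ∀ p, f p = crd τ p v :=
  ⟨{ toFun := fun p => crd τ p v
     map_add' := fun p q => by simp [hF.crd_add h]
     map_smul' := fun t p => by simp [hF.crd_smul h] }, fun _ => rfl⟩

lemma IsFan.continuous_crd (hF : IsFan F) {τ : Finset V} (h : Facet F τ) (v : V) :
    Continuous fun p => crd τ p v := by
  obtain ⟨f, hf⟩ := hF.exists_crd h v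
  simp only [← hf]
  exact f.continuous_of_finiteDimensional

lemma dense_ne_zero (f : V →ₗ[ℝ] ℝ) (hf : f ≠ 0) : Dense {p | f p ≠ 0} := by
  have h : Dense ((LinearMap.ker f : Set V)ᶜ) := by
    rw [← interior_eq_empty_iff_dense_compl]
    by_contra hne
    refine hf (LinearMap.ker_eq_top.1 ((LinearMap.ker f).eq_top_of_nonempty_interior' ?_))
    exact Set.nonempty_iff_ne_empty.2 hne
  exact h

lemma IsFan.crd_self (hF : IsFan F) {τ : Finset V} (h : Facet F τ) {v : V} (hv : v ∈ τ) :
    crd τ v = Finsupp.single v 1 :=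
  hF.crd_eq h (Finsupp.support_single_subset.trans (by simpa using hv)) (by simp)

lemma IsFan.isOpen_dense_generic (hF : IsFan F) :
    IsOpen {p | Generic F p} ∧ Dense {p | Generic F p} := by
  have hfin : {τ | Facet F τ}.Finite := hF.finite.subset fun τ h => h.1
  have heq : {p | Generic F p} =
      ⋂ τ ∈ {τ | Facet F τ}, ⋂ v ∈ τ, {p | crd τ p v ≠ 0} := by
    ext p
    simp only [Set.mem_ofPred_eq, Set.mem_iInter, Generic]
    refine forall_congr' fun τ => forall_congr' fun hτ => ?_
    constructor
    · intro h v hv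
      rwa [← h, Finsupp.mem_support_iff] at hv
    · intro h
      exact (crd_support τ p).antisymm fun v hv => Finsupp.mem_support_iff.2 (h v hv)
  have hop : ∀ τ, Facet F τ → ∀ v, IsOpen {p | crd τ p v ≠ 0} := fun τ hτ v =>
    isOpen_ne_fun (hF.continuous_crd hτ v) continuous_const
  have hop' : ∀ τ, Facet F τ → IsOpen (⋂ v ∈ τ, {p | crd τ p v ≠ 0}) := fun τ hτ =>
    isOpen_biInter_finset fun v _ => hop τ hτ v
  rw [heq]
  refine ⟨hfin.isOpen_biInter hop', dense_biInter_of_isOpen hop' hfin.countable fun τ hτ => ?_⟩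
  refine dense_biInter_of_isOpen (fun v _ => hop τ hτ v) τ.countable_toSet fun v hv => ?_
  obtain ⟨f, hf⟩ := hF.exists_crd hτ v
  simp only [← hf]
  refine dense_ne_zero f fun h0 => ?_
  have := hf v
  rw [hF.crd_self hτ hv, h0] at this
  simp at this

lemma Generic.smul {p : V} (h : Generic F p) (hF : IsFan F) {t : ℝ} (ht : t ≠ 0) :
    Generic F (t • p) := fun τ hτ => by
  rw [hF.crd_smul hτ, Finsupp.support_smul_eq ht, h τ hτ]

lemma IsFan.exists_generic {F' : Set (Finset V)} (hF : IsFan F) (hF' : IsFan F') {U : Set V}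
    (hU : IsOpen U) (hne : U.Nonempty) : ∃ p ∈ U, Generic F p ∧ Generic F' p := by
  obtain ⟨p, hp, h⟩ := (hF.isOpen_dense_generic.2.inter_of_isOpen_left hF'.isOpen_dense_generic.2
    hF.isOpen_dense_generic.1).inter_open_nonempty U hU hne
  exact ⟨p, hp, h⟩

lemma exists_ranks {X : Type*} [LinearOrder X] (hF : IsFan F) {p : V} {P : Finset V → Prop}
    (ρ : Finset V → X) (h : ∀ τ τ', Facet F τ → Facet F τ' → ∀ c, Adj τ τ' c →
      P (τ.erase c) → 0 < crd τ p c → ρ τ' < ρ τ) : ∃ r, Ranks F p P r := by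
  refine ⟨fun σ => ({μ | Facet F μ ∧ ρ μ < ρ σ}.ncard : ℤ), ?_⟩
  intro τ τ' hτ hτ' c hadj hP hc
  have hlt := h τ τ' hτ hτ' c hadj hP hc
  have hfin : {μ | Facet F μ ∧ ρ μ < ρ τ}.Finite := hF.finite.subset fun τ h => h.1.1
  refine Int.ofNat_lt.2 (Set.ncard_lt_ncard ⟨fun μ hμ => ⟨hμ.1, hμ.2.trans hlt⟩, fun hsub => ?_⟩ hfin)
  exact lt_irrefl _ (hsub (show τ' ∈ _ from ⟨hτ', hlt⟩)).2

end Generic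

section Star

variable {V : Type*} [NormedAddCommGroup V] [InnerProductSpace ℝ V] [DecidableEq V]
  [FiniteDimensional ℝ V] {F : Set (Finset V)}

lemma IsFan.exists_facet_not_subset (hF : IsFan F) {s A : Finset V} (hs : s ∈ F) (hA : ¬A ⊆ s) :
    ∃ τ, Facet F τ ∧ ¬A ⊆ τ ∧ s ⊆ τ := by
  obtain ⟨τ, hτ, hsτ⟩ := hF.exists_facet hs
  by_cases hAτ : A ⊆ τ
  · obtain ⟨a, ha, has⟩ := Finset.not_subset.1 hA
    obtain ⟨τ', hτ', hadj⟩ := hF.exists_adj hτ (hAτ ha)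
    exact ⟨τ', hτ', fun h => hadj.2.1 (h ha), fun x hx =>
      hadj.2.2 (Finset.mem_erase.2 ⟨fun h => has (h ▸ hx), hsτ hx⟩)⟩
  · exact ⟨τ, hτ, hAτ, hsτ⟩

lemma coned_coneRegion (hF : IsFan F) {p : V} (hp : Generic F p) (hd : 1 < finrank ℝ V)
    {A : Finset V} (hne : A.Nonempty)
    (hA : ∀ σ, Facet F σ → A ⊆ σ → ∀ a ∈ A, 0 < crd σ p a) :
    coned F p (coneRegion F p A) = {s | s ∈ F ∧ ¬A ⊆ s} ∪
      {t | p ∈ t ∧ ¬A ⊆ t.erase p ∧ t.erase p ∪ A ∈ F} := by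
  have hreg : ∀ σ, Facet F σ → (σ ∈ coneRegion F p A ↔ A ⊆ σ) := by
    intro σ hσ
    obtain ⟨a, ha⟩ := hne
    exact ⟨fun h => h.2.1, fun h => ⟨hσ, h, a, hA σ hσ h a ha⟩⟩
  have h1 : ∀ s, (∃ τ, Facet F τ ∧ τ ∉ coneRegion F p A ∧ s ⊆ τ) ↔ s ∈ F ∧ ¬A ⊆ s := by
    intro s
    constructor
    · rintro ⟨τ, hτ, hτA, hs⟩
      rw [hreg τ hτ] at hτA
      exact ⟨hF.down _ hτ.1 _ hs, fun h => hτA (h.trans hs)⟩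
    · rintro ⟨hs, hAs⟩
      obtain ⟨τ, hτ, h, hsτ⟩ := hF.exists_facet_not_subset hs hAs
      exact ⟨τ, hτ, by rwa [hreg τ hτ], hsτ⟩
  have h2 : ∀ s, (∃ τ, Facet F τ ∧ τ ∈ coneRegion F p A ∧ s ⊆ τ) ↔ s ∪ A ∈ F := by
    intro s
    constructor
    · rintro ⟨τ, hτ, hτA, hs⟩
      exact hF.down _ hτ.1 _ (Finset.union_subset hs ((hreg τ hτ).1 hτA))
    · intro h
      obtain ⟨τ, hτ, hsτ⟩ := hF.exists_facet h
      exact ⟨τ, hτ, (hreg τ hτ).2 (Finset.union_subset_right hsτ), Finset.union_subset_left hsτ⟩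
  ext s
  simp only [coned, Set.mem_union, Set.mem_ofPred_eq, h1, h2]
  refine or_congr ⟨fun h => h.2, fun h => ⟨hp.notMem hF hd h.1, h⟩⟩ ?_
  exact ⟨fun h => ⟨h.1, h.2.2.2, h.2.1⟩, fun h => ⟨h.1, h.2.2, hF.down _ h.2.2 _
    Finset.subset_union_left, h.2.1⟩⟩

/-- The data for starring a fan at an interior point `w` of an edge `{a, b}`. -/
structure Starring (F : Set (Finset V)) (a b w : V) (α β : ℝ) : Prop where
  fan : IsFan F
  ne : a ≠ b
  mem : {a, b} ∈ F
  pos_left : 0 < α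
  pos_right : 0 < β
  eq : α • a + β • b = w
  norm : ‖w‖ = 1

variable {a b w : V} {α β : ℝ}

lemma Starring.symm (S : Starring F a b w α β) : Starring F b a w β α :=
  ⟨S.fan, S.ne.symm, Finset.pair_comm a b ▸ S.mem, S.pos_right, S.pos_left,
    by rw [add_comm, S.eq], S.norm⟩

lemma Starring.notMem (S : Starring F a b w α β) {s : Finset V} (hs : s ∈ F) : w ∉ s := by
  intro hw
  have key := S.fan.inj (Finsupp.single w 1) (Finsupp.single a α + Finsupp.single b β)
    (fun v => ?_) (fun v => ?_) (S.fan.down _ hs _ ?_) (S.fan.down _ S.mem _ ?_) ?_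
  · have h1 := DFunLike.congr_fun key a
    have h2 := DFunLike.congr_fun key b
    have hα := S.pos_left
    have hβ := S.pos_right
    have ha : w = a := by
      by_contra h
      simp [S.ne.symm, h] at h1
      linarith
    have hb : w = b := by
      by_contra h
      simp [S.ne, h] at h2
      linarith
    exact S.ne (ha.symm.trans hb)
  · rw [Finsupp.single_apply]; split_ifs <;> simp
  · have hα := S.pos_left
    have hβ := S.pos_right
    simp only [Finsupp.add_apply, Finsupp.single_apply]
    split_ifs <;> simp <;> linarith
  · exact Finsupp.support_single_subset.trans (by simpa using hw)
  · intro v hv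
    rcases Finset.mem_union.1 (Finsupp.support_add hv) with h | h
    · have := Finsupp.support_single_subset h
      simp_all
    · have := Finsupp.support_single_subset h
      simp_all
  · simp [S.eq]

lemma Starring.ne_left (S : Starring F a b w α β) : w ≠ a := fun h =>
  S.notMem S.mem (by simp [h])

lemma Starring.ne_right (S : Starring F a b w α β) : w ≠ b := fun h =>
  S.notMem S.mem (by simp [h])

/-- The fan obtained by starring. -/
abbrev starred (F : Set (Finset V)) (a b w : V) : Set (Finset V) := flip F {a, b} {w}

lemma Starring.isFan (S : Starring F a b w α β) : IsFan (starred F a b w) := by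
  have hα := S.pos_left
  have hβ := S.pos_right
  refine S.fan.flip (z := Finsupp.single a α + Finsupp.single b β - Finsupp.single w 1)
    ?_ ?_ ?_ ?_ ?_ S.mem ?_ ?_
  · simp [S.eq]
  · intro v
    have := S.ne
    by_cases h1 : v = a
    · subst h1
      simp [S.ne_left, S.ne.symm, hα]
    · by_cases h2 : v = b
      · subst h2
        simp [S.ne_right, S.ne, hβ]
      · simp only [Finset.mem_insert, Finset.mem_singleton, h1, h2, Finsupp.sub_apply,
          Finsupp.add_apply, Finsupp.single_apply, Ne.symm h1, Ne.symm h2, if_false]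
        split_ifs <;> simp
  · intro v
    by_cases h1 : v = w
    · subst h1
      simp [S.ne_left.symm, S.ne_right.symm]
    · simp only [Finset.mem_singleton, h1, Finsupp.sub_apply,
          Finsupp.add_apply, Finsupp.single_apply, Ne.symm h1, if_false]
      split_ifs <;> simp <;> linarith
  · simp
  · simp
  · simpa using S.norm
  · intro s hs _ T hT
    have : T = ∅ := by simpa using hT
    rw [this]
    exact S.fan.down _ hs _ (by simp [Finset.sdiff_subset])

lemma Starring.mem_starred (S : Starring F a b w α β) {s : Finset V} :
    s ∈ starred F a b w ↔
      (w ∉ s ∧ s ∈ F ∧ ¬{a, b} ⊆ s) ∨ (w ∈ s ∧ ¬{a, b} ⊆ s ∧ s.erase w ∪ {a, b} ∈ F) := by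
  simp only [starred, flip, Set.mem_union, Set.mem_ofPred_eq, Finset.singleton_subset_iff,
    Finset.sdiff_singleton_eq_erase]
  refine or_congr ⟨fun h => ⟨S.notMem h.1, h⟩, fun h => h.2⟩ Iff.rfl

lemma Starring.facet_of_notMem (S : Starring F a b w α β) {τ : Finset V}
    (h : Facet (starred F a b w) τ) (hw : w ∉ τ) : Facet F τ ∧ ¬{a, b} ⊆ τ := by
  have := S.mem_starred.1 h.1
  simp only [hw, not_false_eq_true, true_and, false_and, or_false] at this
  exact ⟨⟨this.1, h.2⟩, this.2⟩

lemma Starring.facet_of_mem (S : Starring F a b w α β) {τ : Finset V}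
    (h : Facet (starred F a b w) τ) (hw : w ∈ τ) (hb : b ∈ τ) :
    a ∉ τ ∧ Facet F (insert a (τ.erase w)) ∧ τ.erase w ∪ {a, b} = insert a (τ.erase w) := by
  have := S.mem_starred.1 h.1
  simp only [hw, not_true_eq_false, false_and, true_and, false_or, Finset.insert_subset_iff, hb,
    Finset.singleton_subset_iff, and_true] at this
  have heq : τ.erase w ∪ {a, b} = insert a (τ.erase w) := by
    ext x
    simp only [Finset.mem_union, Finset.mem_erase, Finset.mem_insert, Finset.mem_singleton]
    constructor
    · rintro (h | h | rfl)
      exacts [Or.inr h, Or.inl h, Or.inr ⟨S.ne_right.symm, hb⟩]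
    · rintro (h | h)
      exacts [Or.inr (Or.inl h), Or.inl h]
  refine ⟨this.1, ⟨heq ▸ this.2, ?_⟩, heq⟩
  rw [Finset.card_insert_of_notMem (by simp [this.1]), Finset.card_erase_add_one hw, h.2]

lemma Starring.exists_mem (S : Starring F a b w α β) {τ : Finset V}
    (h : Facet (starred F a b w) τ) (hw : w ∈ τ) : a ∈ τ ∨ b ∈ τ := by
  by_contra! hab
  have := S.mem_starred.1 h.1
  simp only [hw, not_true_eq_false, false_and, true_and, false_or] at this
  obtain ⟨σ, hσ, hsub⟩ := S.fan.exists_facet this.2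
  have h1 := Finset.card_le_card hsub
  rw [Finset.card_union_of_disjoint (by simp [hab]), Finset.card_pair S.ne, hσ.2, ← h.2,
    ← Finset.card_erase_add_one hw] at h1
  omega

lemma Starring.crd_parent (S : Starring F a b w α β) {τ : Finset V}
    (h : Facet (starred F a b w) τ) (hw : w ∈ τ) (hb : b ∈ τ) (p : V) :
    crd (insert a (τ.erase w)) p = crd τ p - crd τ p w •
      (Finsupp.single w 1 - Finsupp.single a α - Finsupp.single b β) := by
  obtain ⟨ha, hf, -⟩ := S.facet_of_mem h hw hb
  refine S.fan.crd_eq hf (fun x hx => ?_) ?_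
  · rw [Finsupp.mem_support_iff] at hx
    by_cases hxa : x = a
    · simp [hxa]
    · by_cases hxw : x = w
      · subst hxw
        simp [S.ne_left.symm, S.ne_right.symm] at hx
      · by_cases hxb : x = b
        · subst hxb
          simp [hb, S.ne_right.symm]
        · simp [Ne.symm hxa, Ne.symm hxw, Ne.symm hxb] at hx
          have : x ∈ τ := crd_support τ p (Finsupp.mem_support_iff.2 hx)
          simp [hxw, this]
  · rw [map_sub, S.isFan.comb_crd h]
    simp [← S.eq]

/-- The facet of the original fan containing a facet of the starred fan. -/
def parent (a b w : V) (τ : Finset V) : Finset V := if w ∈ τ then τ.erase w ∪ {a, b} else τ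

/-- A rank for the starred fan. -/
noncomputable def starRank (r : Finset V → ℤ) (p a b w : V) (τ : Finset V) : ℤ :=
  2 * r (parent a b w τ) + if 0 < crd τ p a ∨ 0 < crd τ p b then 1 else 0

lemma starRank_comm (r : Finset V → ℤ) (p a b w : V) (τ : Finset V) :
    starRank r p a b w τ = starRank r p b a w τ := by
  simp only [starRank, parent, Finset.pair_comm a b, or_comm]

lemma starRank_lt {r : Finset V → ℤ} {p a b w : V} {τ τ' : Finset V}
    (h : r (parent a b w τ') < r (parent a b w τ)) :
    starRank r p a b w τ' < starRank r p a b w τ := by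
  unfold starRank
  split_ifs <;> omega

lemma Starring.starRank_lt_of_mem (S : Starring F a b w α β) {p : V} {P : Finset V → Prop}
    {r : Finset V → ℤ} (hr : Ranks F p P r)
    (hP : ∀ σ, b ∈ σ → P (insert w σ) → P (insert a σ)) {τ τ' : Finset V} {c : V}
    (hτ : Facet (starred F a b w) τ) (hτ' : Facet (starred F a b w) τ') (hadj : Adj τ τ' c)
    (hPc : P (τ.erase c)) (hc : 0 < crd τ p c) (hw : w ∈ τ) (hb : b ∈ τ) :
    starRank r p a b w τ' < starRank r p a b w τ := by
  have hα := S.pos_left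
  obtain ⟨ha, hf, he⟩ := S.facet_of_mem hτ hw hb
  have hpar : parent a b w τ = insert a (τ.erase w) := by rw [parent, if_pos hw, he]
  by_cases hw' : w ∈ τ'
  · have hcw : c ≠ w := fun h => hadj.2.1 (h ▸ hw')
    by_cases hcb : c = b
    · subst hcb
      have ha' : a ∈ τ' := (S.exists_mem hτ' hw').resolve_right hadj.2.1
      obtain ⟨d, hadj', hed⟩ := hadj.exists_symm hτ hτ'
      have hda : d = a := by
        by_contra h
        exact ha (Finset.mem_of_mem_erase (hed ▸ Finset.mem_erase.2 ⟨Ne.symm h, ha'⟩))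
      subst hda
      have hneg := S.isFan.adj_neg hadj hadj' hτ hτ' hc
      have h0 : crd τ' p c = 0 := crd_eq_zero hadj.2.1
      have hpar' : parent d c w τ' = parent d c w τ := by
        rw [parent, if_pos hw', parent, if_pos hw]
        ext x
        have := Finset.ext_iff.1 hed x
        simp only [Finset.mem_erase] at this
        simp only [Finset.mem_union, Finset.mem_erase, Finset.mem_insert, Finset.mem_singleton]
        tauto
      unfold starRank
      rw [hpar', if_pos (Or.inr hc), if_neg (by rw [h0]; simpa using hneg.le)]
      omega
    · have hb' : b ∈ τ' := hadj.2.2 (Finset.mem_erase.2 ⟨Ne.symm hcb, hb⟩)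
      obtain ⟨ha', hf', he'⟩ := S.facet_of_mem hτ' hw' hb'
      have hpar' : parent a b w τ' = insert a (τ'.erase w) := by rw [parent, if_pos hw', he']
      have hca : c ≠ a := fun h => ha (h ▸ hadj.1)
      apply starRank_lt
      rw [hpar, hpar']
      refine hr _ _ hf hf' c ⟨?_, ?_, ?_⟩ ?_ ?_
      · simp [hadj.1, hcw]
      · simp [hadj.2.1, hca]
      · intro x hx
        simp only [Finset.mem_erase, Finset.mem_insert] at hx ⊢
        rcases hx with ⟨h1, h2 | h2⟩
        · exact Or.inl h2
        · exact Or.inr ⟨h2.1, hadj.2.2 (Finset.mem_erase.2 ⟨h1, h2.2⟩)⟩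
      · have e1 : (insert a (τ.erase w)).erase c = insert a ((τ.erase w).erase c) :=
          Finset.erase_insert_of_ne hca.symm
        rw [e1]
        refine hP _ (by simp [hb, Ne.symm hcb, S.ne_right.symm]) ?_
        rwa [Finset.erase_right_comm, Finset.insert_erase]
        exact Finset.mem_erase.2 ⟨Ne.symm hcw, hw⟩
      · rw [S.crd_parent hτ hw hb]
        simpa [Finsupp.single_apply, Ne.symm hcw, Ne.symm hcb, Ne.symm hca] using hc
  · have hcw : c = w := by
      by_contra h
      exact hw' (hadj.2.2 (Finset.mem_erase.2 ⟨Ne.symm h, hw⟩))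
    subst hcw
    obtain ⟨hf', hne⟩ := S.facet_of_notMem hτ' hw'
    have hb' : b ∈ τ' := hadj.2.2 (Finset.mem_erase.2 ⟨S.ne_right.symm, hb⟩)
    have ha' : a ∉ τ' := fun h => hne (by simp [Finset.insert_subset_iff, h, hb'])
    have ea : (insert a (τ.erase c)).erase a = τ.erase c := Finset.erase_insert (by simp [ha])
    apply starRank_lt
    rw [hpar, parent, if_neg hw']
    refine hr _ _ hf hf' a ⟨by simp, ha', ?_⟩ ?_ ?_
    · rw [ea]; exact hadj.2.2
    · rwa [ea]
    · rw [S.crd_parent hτ hw hb]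
      simp [S.ne_left, S.ne.symm, crd_eq_zero ha]
      positivity

lemma Starring.starRank_lt_of_mem_right (S : Starring F a b w α β) {p : V}
    {P : Finset V → Prop} {r : Finset V → ℤ} (hr : Ranks F p P r) {τ τ' : Finset V} {c : V}
    (hτ : Facet (starred F a b w) τ) (hτ' : Facet (starred F a b w) τ') (hadj : Adj τ τ' c)
    (hPc : P (τ.erase c)) (hc : 0 < crd τ p c) (hw : w ∉ τ) (hw' : w ∈ τ')
    (hb : b ∈ τ') : starRank r p a b w τ' < starRank r p a b w τ := by
  obtain ⟨ha', hf', he'⟩ := S.facet_of_mem hτ' hw' hb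
  obtain ⟨hf, hne⟩ := S.facet_of_notMem hτ hw
  obtain ⟨d, hadj', hed⟩ := hadj.exists_symm hτ hτ'
  have hdw : d = w := by
    by_contra h
    exact hw (Finset.mem_of_mem_erase (hed ▸ Finset.mem_erase.2 ⟨Ne.symm h, hw'⟩))
  subst hdw
  have hbτ : b ∈ τ := Finset.mem_of_mem_erase
    (hed ▸ Finset.mem_erase.2 ⟨S.ne_right.symm, hb⟩)
  have ha : a ∉ τ := fun h => hne (by simp [Finset.insert_subset_iff, h, hbτ])
  have hca : c ≠ a := fun h => ha (h ▸ hadj.1)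
  apply starRank_lt
  rw [parent, if_pos hw', he', parent, if_neg hw]
  refine hr _ _ hf hf' c ⟨hadj.1, ?_, ?_⟩ hPc hc
  · simp [hca, hadj.2.1]
  · rw [hed]; exact Finset.subset_insert _ _

lemma Starring.ranks (S : Starring F a b w α β) {p : V} {P : Finset V → Prop}
    {r : Finset V → ℤ} (hr : Ranks F p P r)
    (hPa : ∀ σ, b ∈ σ → P (insert w σ) → P (insert a σ))
    (hPb : ∀ σ, a ∈ σ → P (insert w σ) → P (insert b σ)) :
    Ranks (starred F a b w) p P (starRank r p a b w) := by
  have hsym : starred F a b w = starred F b a w := by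
    unfold starred; rw [Finset.pair_comm]
  intro τ τ' hτ hτ' c hadj hP hc
  by_cases hw : w ∈ τ
  · rcases S.exists_mem hτ hw with h | h
    · rw [starRank_comm r p a b, starRank_comm r p a b]
      exact S.symm.starRank_lt_of_mem hr hPb (hsym ▸ hτ) (hsym ▸ hτ') hadj hP hc hw h
    · exact S.starRank_lt_of_mem hr hPa hτ hτ' hadj hP hc hw h
  · by_cases hw' : w ∈ τ'
    · rcases S.exists_mem hτ' hw' with h | h
      · rw [starRank_comm r p a b, starRank_comm r p a b]
        exact S.symm.starRank_lt_of_mem_right hr (hsym ▸ hτ) (hsym ▸ hτ') hadj hP hc hw hw' h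
      · exact S.starRank_lt_of_mem_right hr hτ hτ' hadj hP hc hw hw' h
    · apply starRank_lt
      rw [parent, if_neg hw', parent, if_neg hw]
      exact hr _ _ (S.facet_of_notMem hτ hw).1 (S.facet_of_notMem hτ' hw').1 c hadj hP hc

end Star

section EdgeStar

variable {V : Type*} [NormedAddCommGroup V] [InnerProductSpace ℝ V] [DecidableEq V]
  [FiniteDimensional ℝ V] {F : Set (Finset V)} {a b w : V} {α β : ℝ}

lemma exists_projection (a b : V) : ∃ π : V →ₗ[ℝ] V, π a = 0 ∧ π b = 0 ∧
    ∀ v, π v = 0 → ∃ s t : ℝ, s • a + t • b = v := by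
  set U : Submodule ℝ V := Submodule.span ℝ {a, b} with hU
  have key : ∀ v, ((LinearMap.id : V →ₗ[ℝ] V) - (U.starProjection : V →ₗ[ℝ] V)) v = 0 ↔ v ∈ U := by
    intro v
    rw [LinearMap.sub_apply, sub_eq_zero, ← Submodule.starProjection_eq_self_iff (K := U)]
    exact eq_comm
  refine ⟨(LinearMap.id : V →ₗ[ℝ] V) - (U.starProjection : V →ₗ[ℝ] V), ?_, ?_, fun v hv => ?_⟩
  · exact (key a).2 (Submodule.subset_span (by simp))
  · exact (key b).2 (Submodule.subset_span (by simp))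
  · exact Submodule.mem_span_pair.1 ((key v).1 hv)

lemma linearCombination_eq_three {M : Type*} [AddCommGroup M] [Module ℝ M] {f : V → M}
    {a b c d x : V} (ha : f a = 0) (hb : f b = 0) (hcd : c ≠ d) (hcx : c ≠ x) (hdx : d ≠ x)
    {k : V →₀ ℝ} (hk : k.support ⊆ {a, b, c, d, x}) :
    Finsupp.linearCombination ℝ f k = k c • f c + k d • f d + k x • f x := by
  rw [Finsupp.linearCombination_apply, Finsupp.sum_of_support_subset _ hk _ (by simp)]
  rw [← Finset.sum_subset (s₁ := {c, d, x}), Finset.sum_insert, Finset.sum_pair hdx, add_assoc]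
  · simp [hcd, hcx]
  · intro y hy; simp at hy ⊢; tauto
  · intro y hy hy'
    simp only [Finset.mem_insert, Finset.mem_singleton, not_or] at hy hy'
    rcases hy with rfl | rfl | h
    · simp [ha]
    · simp [hb]
    · tauto

lemma IsFan.ranks_edge (hF : IsFan F) (hd : finrank ℝ V = 4) (hab : a ≠ b) (p : V)
    {P : Finset V → Prop} (hP : ∀ s ∈ F, P s → {a, b} ⊆ s) : ∃ r, Ranks F p P r := by
  obtain ⟨π, hπa, hπb, hπ⟩ := exists_projection a b
  refine exists_ranks hF (fun σ => Finsupp.linearCombination ℝ (fun v => ‖π v‖) (crd σ p)) ?_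
  intro τ τ' hτ hτ' c hadj hPc hc
  have hsub := hP _ (hF.down _ hτ.1 _ (Finset.erase_subset _ _)) hPc
  obtain ⟨d, hadj', hed⟩ := hadj.exists_symm hτ hτ'
  have hd0 := hF.adj_neg hadj hadj' hτ hτ' hc
  obtain ⟨x, hx⟩ : ∃ x, τ.erase c \ {a, b} = {x} := by
    rw [← Finset.card_eq_one]
    have h1 := Finset.card_sdiff_add_card_eq_card hsub
    have h2 := Finset.card_erase_add_one hadj.1
    rw [hτ.2, hd] at h2
    rw [Finset.card_pair hab] at h1
    omega
  have hwall : ∀ v, v ∈ τ.erase c ↔ v = a ∨ v = b ∨ v = x := by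
    intro v
    have h1 := Finset.ext_iff.1 hx v
    have h2 := @hsub v
    simp only [Finset.mem_sdiff, Finset.mem_insert, Finset.mem_singleton] at h1 h2
    tauto
  have hxw : x ∈ τ.erase c ∧ x ∉ ({a, b} : Finset V) := by
    rw [← Finset.mem_sdiff, hx]; simp
  have haw : a ∈ τ.erase c := (hwall a).2 (Or.inl rfl)
  have hbw : b ∈ τ.erase c := (hwall b).2 (Or.inr (Or.inl rfl))
  have hxa : x ≠ a := fun h => hxw.2 (by simp [h])
  have hxb : x ≠ b := fun h => hxw.2 (by simp [h])
  have hcx : c ≠ x := fun h => (Finset.mem_erase.1 hxw.1).1 h.symm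
  have hca : c ≠ a := fun h => (Finset.mem_erase.1 haw).1 h.symm
  have hcb : c ≠ b := fun h => (Finset.mem_erase.1 hbw).1 h.symm
  have hdx : d ≠ x := fun h => by
    have := hed ▸ hxw.1
    exact (Finset.mem_erase.1 this).1 h.symm
  have hcd : c ≠ d := fun h => hadj'.2.1 (h ▸ hadj.1)
  have hτsub : ∀ v ∈ τ, v = c ∨ v = a ∨ v = b ∨ v = x := by
    intro v hv
    by_cases h : v = c
    · exact Or.inl h
    · exact Or.inr ((hwall v).1 (Finset.mem_erase.2 ⟨h, hv⟩))
  have hτsub' : ∀ v ∈ τ', v = d ∨ v = a ∨ v = b ∨ v = x := by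
    intro v hv
    by_cases h : v = d
    · exact Or.inl h
    · exact Or.inr ((hwall v).1 (hed ▸ Finset.mem_erase.2 ⟨h, hv⟩))
  set D := crd τ p - crd τ' p with hD
  have hDs : D.support ⊆ {a, b, c, d, x} := by
    intro v hv
    simp only [Finset.mem_insert, Finset.mem_singleton]
    rcases Finset.mem_union.1 (Finsupp.support_sub hv) with h | h
    · have := hτsub v (crd_support _ _ h); tauto
    · have := hτsub' v (crd_support _ _ h); tauto
  have hDc : 0 < D c := by simp [hD, crd_eq_zero hadj.2.1, hc]
  have hDd : 0 < D d := by simp [hD, crd_eq_zero hadj'.2.1, hd0]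
  have hind : ∀ s t : ℝ, s • π c + t • π x = 0 → s = 0 := by
    intro s t h
    rw [← map_smul, ← map_smul, ← map_add] at h
    obtain ⟨u, v, huv⟩ := hπ _ h
    have key := hF.indep hτ.1 (k := Finsupp.single c s + Finsupp.single x t)
      (k' := Finsupp.single a u + Finsupp.single b v) ?_ ?_ (by simp [huv])
    · have := DFunLike.congr_fun key c
      simpa [hcx, hcx.symm, hca.symm, hcb.symm] using this
    · refine Finsupp.support_add.trans (Finset.union_subset ?_ ?_)
      · exact Finsupp.support_single_subset.trans (by simpa using hadj.1)
      · exact Finsupp.support_single_subset.trans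
          (by simpa using Finset.mem_of_mem_erase hxw.1)
    · refine Finsupp.support_add.trans (Finset.union_subset ?_ ?_)
      · exact Finsupp.support_single_subset.trans
          (by simpa using Finset.mem_of_mem_erase haw)
      · exact Finsupp.support_single_subset.trans
          (by simpa using Finset.mem_of_mem_erase hbw)
  have hrel : D c • π c + D d • π d + D x • π x = 0 := by
    rw [← linearCombination_eq_three (f := π) hπa hπb hcd hcx hdx hDs]
    have : comb D = 0 := by rw [hD, map_sub, hF.comb_crd hτ, hF.comb_crd hτ', sub_self]
    have h2 := Finsupp.apply_linearCombination ℝ π (id : V → V) D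
    rw [this, map_zero] at h2
    exact h2.symm
  have hπc : 0 < ‖π c‖ := by
    rw [norm_pos_iff]
    intro h
    have := hind 1 0 (by simp [h])
    exact one_ne_zero this
  rw [← sub_pos, ← map_sub, ← hD,
    linearCombination_eq_three (f := fun v => ‖π v‖) (by simp [hπa]) (by simp [hπb]) hcd hcx hdx
      hDs]
  simp only [smul_eq_mul]
  rcases le_or_gt 0 (D x) with hDx | hDx
  · positivity
  · have hlt : ‖D c • π c + D d • π d‖ < ‖D c • π c‖ + ‖D d • π d‖ := by
      apply norm_add_lt_of_not_sameRay
      intro hray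
      have hc0 : D c • π c ≠ 0 := smul_ne_zero hDc.ne' (norm_pos_iff.1 hπc)
      have hd0 : D d • π d ≠ 0 := by
        intro h
        rw [h, add_zero] at hrel
        exact hDc.ne' (hind _ _ hrel)
      obtain ⟨s, hs, hsd⟩ := hray.exists_pos_left hc0 hd0
      rw [← hsd, smul_smul, ← add_smul] at hrel
      have := hind _ _ hrel
      nlinarith [mul_pos hs hDc]
    rw [eq_neg_of_add_eq_zero_left hrel, norm_neg, norm_smul, norm_smul, norm_smul,
      Real.norm_of_nonneg hDc.le, Real.norm_of_nonneg hDd.le, Real.norm_of_nonpos hDx.le] at hlt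
    linarith

lemma IsFan.isOpen_pos (hF : IsFan F) (A : Finset V) :
    IsOpen {p | ∀ σ, Facet F σ → A ⊆ σ → ∀ v ∈ A, 0 < crd σ p v} := by
  have heq : {p | ∀ σ, Facet F σ → A ⊆ σ → ∀ v ∈ A, 0 < crd σ p v} =
      ⋂ σ ∈ {σ | Facet F σ ∧ A ⊆ σ}, ⋂ v ∈ A, {p | 0 < crd σ p v} := by
    ext p; simp
  rw [heq]
  have hfin : {σ | Facet F σ ∧ A ⊆ σ}.Finite := hF.finite.subset fun τ h => h.1.1
  exact hfin.isOpen_biInter fun σ hσ => isOpen_biInter_finset fun v _ =>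
    isOpen_lt continuous_const (hF.continuous_crd hσ.1 v)

lemma Starring.linked (S : Starring F a b w α β) (hd : finrank ℝ V = 4) :
    Linked F (starred F a b w) := by
  have hF := S.fan
  have hF' := S.isFan
  have hα := S.pos_left
  have hβ := S.pos_right
  set U := {p | ∀ σ, Facet F σ → {a, b} ⊆ σ → ∀ v ∈ ({a, b} : Finset V), 0 < crd σ p v} ∩
    {p | ∀ σ, Facet (starred F a b w) σ → {w} ⊆ σ → ∀ v ∈ ({w} : Finset V), 0 < crd σ p v}
    with hU
  have hwU : w ∈ U := by
    constructor
    · intro σ hσ hsub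
      have hs : crd σ w = Finsupp.single a α + Finsupp.single b β := by
        refine hF.crd_eq hσ (Finsupp.support_add.trans (Finset.union_subset ?_ ?_))
          (by simp [S.eq])
        · exact Finsupp.support_single_subset.trans
            (by simpa using hsub (Finset.mem_insert_self _ _))
        · exact Finsupp.support_single_subset.trans (by simpa using hsub (by simp))
      simp [hs, S.ne, S.ne.symm, hα, hβ]
    · intro σ hσ hsub
      simp [hF'.crd_self hσ (Finset.singleton_subset_iff.1 hsub)]
  obtain ⟨q, hqU, hq, hq'⟩ := hF.exists_generic hF' ((hF.isOpen_pos _).inter (hF'.isOpen_pos _))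
    ⟨w, hwU⟩
  have hq0 : q ≠ 0 := by
    rintro rfl
    obtain ⟨σ, hσ, hsub⟩ := hF.exists_facet S.mem
    have := hqU.1 σ hσ hsub a (by simp)
    rw [show (0 : V) = (0 : ℝ) • (0 : V) by simp, hF.crd_smul hσ] at this
    simp at this
  have hn : 0 < ‖q‖⁻¹ := inv_pos.2 (norm_pos_iff.2 hq0)
  set p := ‖q‖⁻¹ • q with hp
  have hp1 : ‖p‖ = 1 := by
    rw [hp, norm_smul, norm_inv, norm_norm, inv_mul_cancel₀ (norm_ne_zero_iff.2 hq0)]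
  have hpg : Generic F p := hq.smul hF hn.ne'
  have hpg' : Generic (starred F a b w) p := hq'.smul hF' hn.ne'
  have hpos : ∀ σ, Facet F σ → {a, b} ⊆ σ → ∀ v ∈ ({a, b} : Finset V), 0 < crd σ p v := by
    intro σ hσ hsub v hv
    rw [hp, hF.crd_smul hσ]
    exact mul_pos hn (hqU.1 σ hσ hsub v hv)
  have hpos' : ∀ σ, Facet (starred F a b w) σ → {w} ⊆ σ → ∀ v ∈ ({w} : Finset V),
      0 < crd σ p v := by
    intro σ hσ hsub v hv
    rw [hp, hF'.crd_smul hσ]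
    exact mul_pos hn (hqU.2 σ hσ hsub v hv)
  obtain ⟨r, hr⟩ := hF.ranks_edge hd S.ne p (P := fun σ => {a, b} ⊆ σ ∨ w ∈ σ)
    fun s hs h => h.resolve_right (S.notMem hs)
  have hr' := S.ranks hr
    (fun σ hb _ => Or.inl (by simp [Finset.insert_subset_iff, hb]))
    (fun σ ha _ => Or.inl (by simp [Finset.insert_subset_iff, ha]))
  have h1 := linked_coned hF hpg hp1 (by omega) hr (fun t ht => Or.inl ht) hpos
  have h2 := linked_coned hF' hpg' hp1 (by omega) hr'
    (fun t ht => Or.inr (Finset.singleton_subset_iff.1 ht)) hpos'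
  rw [coned_coneRegion hF hpg (by omega) (by simp) hpos] at h1
  rw [coned_coneRegion hF' hpg' (by omega) (by simp) hpos'] at h2
  refine h1.trans ?_
  convert h2.symm using 1
  ext s
  simp only [Set.mem_union, Set.mem_ofPred_eq, S.mem_starred, Finset.singleton_subset_iff]
  refine or_congr ?_ (and_congr_right fun _ => ?_)
  · have := @S.notMem
    constructor
    · intro h
      exact ⟨Or.inl ⟨S.notMem h.1, h⟩, S.notMem h.1⟩
    · tauto
  · have hwab : w ∉ ({a, b} : Finset V) := by simp [S.ne_left, S.ne_right]
    have hw1 : w ∈ s.erase p ∪ {w} := by simp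
    simp only [hw1, not_true_eq_false, false_and, true_and, false_or]
    have hs1 : {a, b} ⊆ s.erase p ∪ {w} ↔ {a, b} ⊆ s.erase p := by
      simp [Finset.insert_subset_iff, S.ne_left.symm, S.ne_right.symm]
    rw [hs1]
    constructor
    · rintro ⟨h1, h2⟩
      have hw2 : w ∉ s.erase p := fun h => S.notMem h2 (Finset.mem_union_left _ h)
      refine ⟨hw2, h1, ?_⟩
      rwa [Finset.union_comm (s.erase p), ← Finset.insert_eq, Finset.erase_insert hw2]
    · rintro ⟨hw2, h1, h2⟩
      rw [Finset.union_comm (s.erase p), ← Finset.insert_eq, Finset.erase_insert hw2] at h2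
      exact ⟨h1, h2⟩

end EdgeStar

section Refine

variable {V : Type*} [NormedAddCommGroup V] [InnerProductSpace ℝ V] [DecidableEq V]
  [FiniteDimensional ℝ V] {F : Set (Finset V)}

/-- No edge of the fan crosses the kernel of `h`. -/
def NoCross (h : V →ₗ[ℝ] ℝ) (F : Set (Finset V)) : Prop :=
  ∀ x y, {x, y} ∈ F → 0 < h x → 0 ≤ h y

/-- No functional in `H` vanishes on all of `σ`. -/
def Transverse (H : Set (V →ₗ[ℝ] ℝ)) (σ : Finset V) : Prop := ∀ h ∈ H, ∃ x ∈ σ, h x ≠ 0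

lemma exists_starring (hF : IsFan F) {h : V →ₗ[ℝ] ℝ} {a b : V} (hab : {a, b} ∈ F)
    (ha : 0 < h a) (hb : h b < 0) : ∃ w α β, Starring F a b w α β ∧ h w = 0 := by
  have hne : a ≠ b := fun e => by rw [e] at ha; exact lt_asymm ha hb
  set u := (-h b) • a + h a • b with hu
  have hu0 : u ≠ 0 := by
    intro h0
    have key := hF.indep hab (k := Finsupp.single a (-h b)) (k' := Finsupp.single b (-h a))
      (Finsupp.support_single_subset.trans (by simp))
      (Finsupp.support_single_subset.trans (by simp)) (by
        simp only [Finsupp.linearCombination_single, id]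
        rw [neg_smul (h a), eq_neg_iff_add_eq_zero]; exact h0)
    have := DFunLike.congr_fun key a
    simp [hne.symm] at this
    linarith
  have hn : 0 < ‖u‖⁻¹ := inv_pos.2 (norm_pos_iff.2 hu0)
  refine ⟨‖u‖⁻¹ • u, ‖u‖⁻¹ * (-h b), ‖u‖⁻¹ * h a, ⟨hF, hne, hab, mul_pos hn (by linarith),
    mul_pos hn ha, ?_, ?_⟩, ?_⟩
  · rw [hu, smul_add, smul_smul, smul_smul]
  · rw [norm_smul, norm_inv, norm_norm, inv_mul_cancel₀ (norm_ne_zero_iff.2 hu0)]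
  · simp only [hu, map_smul, map_add, smul_eq_mul]
    ring

lemma Starring.noCross {a b w : V} {α β : ℝ} (S : Starring F a b w α β) {h : V →ₗ[ℝ] ℝ}
    (hh : NoCross h F) : NoCross h (starred F a b w) := by
  have hα := S.pos_left
  have hβ := S.pos_right
  have hw : h w = α * h a + β * h b := by rw [← S.eq]; simp
  have hwF : ∀ y, {w, y} ∈ starred F a b w → y ≠ w → {a, y} ∈ F ∧ {b, y} ∈ F := by
    intro y hy hyw
    have := S.mem_starred.1 hy
    simp only [Finset.mem_insert, true_or, not_true_eq_false, false_and, true_and,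
      false_or] at this
    have h2 : y ∈ ({w, y} : Finset V).erase w := by simp [hyw]
    constructor
    · exact S.fan.down _ this.2 _ (by
        intro v hv; simp at hv; rcases hv with rfl | rfl
        · simp
        · exact Finset.mem_union_left _ h2)
    · exact S.fan.down _ this.2 _ (by
        intro v hv; simp at hv; rcases hv with rfl | rfl
        · simp
        · exact Finset.mem_union_left _ h2)
  intro x y hxy hx
  by_contra! hy
  have hne : x ≠ y := fun e => by rw [e] at hx; exact lt_asymm hx hy
  by_cases hxw : x = w
  · subst hxw
    obtain ⟨h1, h2⟩ := hwF y hxy hne.symm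
    have h3 : ¬0 < h a := fun h => not_le.2 hy (hh _ _ h1 h)
    have h4 : ¬0 < h b := fun h => not_le.2 hy (hh _ _ h2 h)
    rw [not_lt] at h3 h4
    nlinarith [mul_nonneg hα.le (neg_nonneg.2 h3), mul_nonneg hβ.le (neg_nonneg.2 h4)]
  · by_cases hyw : y = w
    · subst hyw
      rw [Finset.pair_comm] at hxy
      obtain ⟨h1, h2⟩ := hwF x hxy hne
      rw [Finset.pair_comm] at h1 h2
      have h3 := hh _ _ h1 hx
      have h4 := hh _ _ h2 hx
      nlinarith [mul_nonneg hα.le h3, mul_nonneg hβ.le h4]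
    · have := S.mem_starred.1 hxy
      simp only [Finset.mem_insert, Finset.mem_singleton, Ne.symm hxw, Ne.symm hyw, or_self,
        not_false_eq_true, true_and, false_and, or_false] at this
      exact not_le.2 hy (hh _ _ this.1 hx)

lemma Starring.ranks_transverse {a b w : V} {α β : ℝ} (S : Starring F a b w α β)
    {H : Set (V →ₗ[ℝ] ℝ)} (hr : ∀ p, ∃ r, Ranks F p (Transverse H) r) (p : V) :
    ∃ r, Ranks (starred F a b w) p (Transverse H) r := by
  obtain ⟨r, hr⟩ := hr p
  have hw : ∀ h : V →ₗ[ℝ] ℝ, h w ≠ 0 → h a ≠ 0 ∨ h b ≠ 0 := by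
    intro h hw
    by_contra! hab
    apply hw
    rw [← S.eq]
    simp [hab]
  refine ⟨_, S.ranks hr ?_ ?_⟩
  · intro σ hb hP h hh
    obtain ⟨x, hx, hx0⟩ := hP h hh
    rcases Finset.mem_insert.1 hx with rfl | hx
    · rcases hw h hx0 with h0 | h0
      · exact ⟨a, by simp, h0⟩
      · exact ⟨b, by simp [hb], h0⟩
    · exact ⟨x, by simp [hx], hx0⟩
  · intro σ ha hP h hh
    obtain ⟨x, hx, hx0⟩ := hP h hh
    rcases Finset.mem_insert.1 hx with rfl | hx
    · rcases hw h hx0 with h0 | h0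
      · exact ⟨a, by simp [ha], h0⟩
      · exact ⟨b, by simp, h0⟩
    · exact ⟨x, by simp [hx], hx0⟩

lemma exists_noCross (hd : finrank ℝ V = 4) (H : Set (V →ₗ[ℝ] ℝ)) (h : V →ₗ[ℝ] ℝ)
    (J : Set (V →ₗ[ℝ] ℝ)) (n : ℕ) : ∀ F : Set (Finset V), IsFan F →
    (∀ p, ∃ r, Ranks F p (Transverse H) r) → (∀ g ∈ J, NoCross g F) →
    {e ∈ F | ∃ x y, e = {x, y} ∧ 0 < h x ∧ h y < 0}.ncard = n →
    ∃ G, Linked F G ∧ (∀ p, ∃ r, Ranks G p (Transverse H) r) ∧ (∀ g ∈ J, NoCross g G) ∧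
      NoCross h G := by
  induction n using Nat.strong_induction_on with
  | _ n ih =>
    intro F hF hr hJ hn
    by_cases hc : NoCross h F
    · exact ⟨F, Linked.refl hF, hr, hJ, hc⟩
    · simp only [NoCross, not_forall, not_le] at hc
      obtain ⟨a, b, hab, ha, hb⟩ := hc
      obtain ⟨w, α, β, S, hw⟩ := exists_starring hF hab ha hb
      have hlt : {e ∈ starred F a b w | ∃ x y, e = {x, y} ∧ 0 < h x ∧ h y < 0}.ncard < n := by
        rw [← hn]
        refine Set.ncard_lt_ncard ⟨?_, ?_⟩ (hF.finite.subset fun e he => he.1)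
        · rintro e ⟨he, x, y, rfl, hx, hy⟩
          refine ⟨?_, x, y, rfl, hx, hy⟩
          have hxw : w ≠ x := fun e => by rw [← e, hw] at hx; exact lt_irrefl _ hx
          have hyw : w ≠ y := fun e => by rw [← e, hw] at hy; exact lt_irrefl _ hy
          have := S.mem_starred.1 he
          simp only [Finset.mem_insert, Finset.mem_singleton, hxw, hyw, or_self,
            not_false_eq_true, true_and, false_and, or_false] at this
          exact this.1
        · intro hsub
          have := (hsub ⟨hab, a, b, rfl, ha, hb⟩ : _ ∈ _).1
          rcases S.mem_starred.1 this with h1 | h1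
          · exact h1.2.2 le_rfl
          · exact h1.2.1 le_rfl
      obtain ⟨G, hl, h1, h2, h3⟩ := ih _ hlt _ S.isFan (S.ranks_transverse hr)
        (fun g hg => S.noCross (hJ g hg)) rfl
      exact ⟨G, (S.linked hd).trans hl, h1, h2, h3⟩

lemma exists_noCross_all (hd : finrank ℝ V = 4) {H : Set (V →ₗ[ℝ] ℝ)} (hH : H.Finite)
    (hF : IsFan F) (hr : ∀ p, ∃ r, Ranks F p (Transverse H) r) :
    ∃ G, Linked F G ∧ (∀ p, ∃ r, Ranks G p (Transverse H) r) ∧ ∀ h ∈ H, NoCross h G := by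
  have key : ∀ J ⊆ H, ∃ G, Linked F G ∧ (∀ p, ∃ r, Ranks G p (Transverse H) r) ∧
      ∀ h ∈ J, NoCross h G := by
    intro J hJ
    induction J, hH.subset hJ using Set.Finite.induction_on with
    | empty => exact ⟨F, Linked.refl hF, hr, by simp⟩
    | @insert h J _ _ ih =>
      obtain ⟨G, hl, h1, h2⟩ := ih ((Set.subset_insert _ _).trans hJ)
      obtain ⟨G', hl', h1', h2', h3'⟩ := exists_noCross hd H h J _ G hl.isFan_right h1 h2 rfl
      refine ⟨G', hl.trans hl', h1', ?_⟩
      rintro g (rfl | hg)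
      exacts [h3', h2' g hg]
  exact key H le_rfl

/-- The fan admits, for each `p`, a rank function compatible with all of its walls. -/
def Ranked (F : Set (Finset V)) : Prop := ∀ p, ∃ r, Ranks F p (fun _ => True) r

lemma ranked_of_noCross (hF : IsFan F) {H : Set (V →ₗ[ℝ] ℝ)} (hH : H.Finite)
    (h0 : ∀ h ∈ H, h ≠ 0) (hr : ∀ p, ∃ r, Ranks F p (Transverse H) r)
    (hc : ∀ h ∈ H, NoCross h F) : Ranked F := by
  intro p
  obtain ⟨r, hr⟩ := hr p
  have hsign : ∀ τ ∈ F, ∀ h ∈ H, ∀ x ∈ τ, 0 < h x → 0 < h (∑ v ∈ τ, v) := by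
    intro τ hτ h hh x hx hpos
    rw [map_sum]
    refine Finset.sum_pos' (fun y hy => hc h hh x y (hF.down _ hτ _ ?_) hpos) ⟨x, hx, hpos⟩
    intro z hz; simp at hz; rcases hz with rfl | rfl <;> assumption
  have hsign' : ∀ τ ∈ F, ∀ h ∈ H, ∀ x ∈ τ, h x < 0 → h (∑ v ∈ τ, v) < 0 := by
    intro τ hτ h hh x hx hneg
    have hle : ∀ y ∈ τ, h y ≤ 0 := by
      intro y hy
      by_contra! hpos
      refine not_le.2 hneg (hc h hh y x (hF.down _ hτ _ ?_) hpos)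
      intro z hz; simp at hz; rcases hz with rfl | rfl <;> assumption
    rw [map_sum, ← neg_pos, ← Finset.sum_neg_distrib]
    exact Finset.sum_pos' (fun y hy => by linarith [hle y hy]) ⟨x, hx, by linarith⟩
  set N : Finset V → ℕ := fun τ => {h ∈ H | 0 < h p * h (∑ v ∈ τ, v)}.ncard with hN
  refine exists_ranks hF (X := ℕ ×ₗ ℤ) (fun σ => toLex (N σ, r σ)) ?_
  intro τ τ' hτ hτ' c hadj _ hpc
  rw [Prod.Lex.toLex_lt_toLex]
  obtain ⟨d, hadj', hed⟩ := hadj.exists_symm hτ hτ'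
  have hpd := hF.adj_neg hadj hadj' hτ hτ' hpc
  have hsame : ∀ h ∈ H, ∀ x ∈ τ.erase c, h x ≠ 0 →
      (0 < h p * h (∑ v ∈ τ, v) ↔ 0 < h p * h (∑ v ∈ τ', v)) := by
    intro h hh x hx hx0
    have hxτ := Finset.mem_of_mem_erase hx
    have hxτ' := hadj.2.2 hx
    rcases hx0.lt_or_gt with h1 | h1
    · have h2 := hsign' τ hτ.1 h hh x hxτ h1
      have h3 := hsign' τ' hτ'.1 h hh x hxτ' h1
      constructor <;> intro h4 <;> [exact mul_pos_of_neg_of_neg (by nlinarith) h3;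
        exact mul_pos_of_neg_of_neg (by nlinarith) h2]
    · have h2 := hsign τ hτ.1 h hh x hxτ h1
      have h3 := hsign τ' hτ'.1 h hh x hxτ' h1
      rw [mul_pos_iff_of_pos_right h2, mul_pos_iff_of_pos_right h3]
  have hval : ∀ (σ : Finset V) (e : V), Facet F σ → e ∈ σ → ∀ h : V →ₗ[ℝ] ℝ,
      (∀ x ∈ σ.erase e, h x = 0) →
      h p = crd σ p e * h e ∧ h (∑ v ∈ σ, v) = h e := by
    intro σ e hσ he h hz
    constructor
    · conv_lhs => rw [← hF.comb_crd hσ p]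
      rw [Finsupp.linearCombination_apply,
        Finsupp.sum_of_support_subset _ (crd_support σ p) _ (by simp), map_sum,
        Finset.sum_eq_single_of_mem e he]
      · simp
      · intro x hx hxe
        simp [hz x (Finset.mem_erase.2 ⟨hxe, hx⟩)]
    · rw [map_sum, Finset.sum_eq_single_of_mem e he]
      intro x hx hxe
      exact hz x (Finset.mem_erase.2 ⟨hxe, hx⟩)
  have hdiff : ∀ h ∈ H, (∀ x ∈ τ.erase c, h x = 0) →
      0 < h p * h (∑ v ∈ τ, v) ∧ ¬0 < h p * h (∑ v ∈ τ', v) := by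
    intro h hh hz
    obtain ⟨h1, h2⟩ := hval τ c hτ hadj.1 h hz
    obtain ⟨h1', h2'⟩ := hval τ' d hτ' hadj'.1 h (hed ▸ hz)
    have hc0 : h c ≠ 0 := by
      intro hc0
      refine h0 h hh (LinearMap.ext fun q => ?_)
      rw [LinearMap.zero_apply, ← hF.comb_crd hτ q, Finsupp.linearCombination_apply,
        Finsupp.sum_of_support_subset _ (crd_support τ q) _ (by simp), map_sum]
      refine Finset.sum_eq_zero fun x hx => ?_
      have : h x = 0 := by
        by_cases hxc : x = c
        · rw [hxc, hc0]
        · exact hz x (Finset.mem_erase.2 ⟨hxc, hx⟩)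
      simp [this]
    constructor
    · rw [h2, h1, mul_assoc]
      exact mul_pos hpc (mul_self_pos.2 hc0)
    · rw [h2', h1', mul_assoc, not_lt]
      exact mul_nonpos_of_nonpos_of_nonneg hpd.le (mul_self_nonneg _)
  have hsub : {h ∈ H | 0 < h p * h (∑ v ∈ τ', v)} ⊆ {h ∈ H | 0 < h p * h (∑ v ∈ τ, v)} := by
    rintro h ⟨hh, hpos⟩
    refine ⟨hh, ?_⟩
    by_cases hz : ∀ x ∈ τ.erase c, h x = 0
    · exact (hdiff h hh hz).1
    · push Not at hz
      obtain ⟨x, hx, hx0⟩ := hz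
      exact (hsame h hh x hx hx0).2 hpos
  by_cases hT : Transverse H (τ.erase c)
  · right
    refine ⟨?_, hr τ τ' hτ hτ' c hadj hT hpc⟩
    simp only [hN]
    congr 1
    refine hsub.antisymm ?_
    rintro h ⟨hh, hpos⟩
    obtain ⟨x, hx, hx0⟩ := hT h hh
    exact ⟨hh, (hsame h hh x hx hx0).1 hpos⟩
  · left
    simp only [Transverse, not_forall, not_exists, not_and, not_not] at hT
    obtain ⟨h, hh, hz⟩ := hT
    refine Set.ncard_lt_ncard ⟨hsub, fun hs => ?_⟩ (hH.subset fun h hh => hh.1)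
    exact (hdiff h hh hz).2 (hs ⟨hh, (hdiff h hh hz).1⟩).2

lemma IsFan.exists_ranked (hF : IsFan F) (hd : finrank ℝ V = 4) :
    ∃ G, Linked F G ∧ Ranked G := by
  have hfin : {τ | Facet F τ}.Finite := hF.finite.subset fun τ h => h.1
  choose! f hf using fun (τ : Finset V) (hτ : Facet F τ) => hF.exists_crd hτ
  set H : Set (V →ₗ[ℝ] ℝ) := ⋃ τ ∈ {τ | Facet F τ}, f τ '' τ with hHdef
  have hH : H.Finite := hfin.biUnion fun τ _ => τ.finite_toSet.image _
  have hmem : ∀ τ, Facet F τ → ∀ c ∈ τ, f τ c ∈ H := fun τ hτ c hc =>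
    Set.mem_biUnion (show τ ∈ {τ | Facet F τ} from hτ) ⟨c, hc, rfl⟩
  have hval : ∀ τ, Facet F τ → ∀ c, ∀ x ∈ τ, f τ c x = if x = c then 1 else 0 := by
    intro τ hτ c x hx
    rw [hf τ hτ c x, hF.crd_self hτ hx, Finsupp.single_apply]
  obtain ⟨G, hl, hr, hc⟩ := exists_noCross_all hd hH hF fun p => ⟨0, by
    intro τ τ' hτ _ c hadj hT _
    obtain ⟨x, hx, hx0⟩ := hT _ (hmem τ hτ c hadj.1)
    rw [Finset.mem_erase] at hx
    rw [hval τ hτ c x hx.2, if_neg hx.1] at hx0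
    exact absurd rfl hx0⟩
  refine ⟨G, hl, ranked_of_noCross hl.isFan_right hH ?_ hr hc⟩
  rintro h hh rfl
  simp only [hHdef, Set.mem_iUnion] at hh
  obtain ⟨τ, hτ, c, hcτ, h0⟩ := hh
  have := hval τ hτ c c hcτ
  rw [h0] at this
  simp at this

end Refine

section Endgame

variable {V : Type*} [NormedAddCommGroup V] [InnerProductSpace ℝ V] [DecidableEq V]
  [FiniteDimensional ℝ V] {F G : Set (Finset V)}

/-- The boundary complex of a simplex. -/
def bdry (S : Finset V) : Set (Finset V) := {s | s ⊂ S}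

lemma coned_of_neg (hF : IsFan F) {p : V} (hp : Generic F p) (hd : 1 < finrank ℝ V)
    {τ : Finset V} (hτ : Facet F τ) (hneg : ∀ v ∈ τ, crd τ p v < 0) :
    coned F p (coneRegion F p ∅) = bdry (insert p τ) := by
  have hpτ : p ∉ τ := hp.notMem hF hd hτ.1
  have hreg : ∀ σ, Facet F σ → (σ ∈ coneRegion F p ∅ ↔ σ ≠ τ) := by
    intro σ hσ
    constructor
    · rintro ⟨-, -, c, hc⟩ rfl
      have hcσ : c ∈ σ := by
        by_contra h
        rw [crd_eq_zero h] at hc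
        exact lt_irrefl _ hc
      exact lt_asymm hc (hneg c hcσ)
    · intro hne
      refine ⟨hσ, Finset.empty_subset _, ?_⟩
      by_contra! hall
      have key := hF.star_unique (s := ∅) (k := crd σ (-p)) (k' := crd τ (-p))
        (fun v _ => ?_) (fun v _ => ?_) ?_ ?_ ?_
      · rw [hF.crd_neg hσ, hF.crd_neg hτ, neg_inj] at key
        exact hne (by rw [← hp σ hσ, key, hp τ hτ])
      · rw [hF.crd_neg hσ]; simpa using hall v
      · rw [hF.crd_neg hτ]
        by_cases hv : v ∈ τ
        · simpa using (hneg v hv).le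
        · simp [crd_eq_zero hv]
      · exact hF.down _ hσ.1 _ (by simpa using crd_support σ (-p))
      · exact hF.down _ hτ.1 _ (by simpa using crd_support τ (-p))
      · rw [hF.comb_crd hσ, hF.comb_crd hτ]
  have h1 : ∀ s, (∃ σ, Facet F σ ∧ σ ∉ coneRegion F p ∅ ∧ s ⊆ σ) ↔ s ⊆ τ := by
    intro s
    constructor
    · rintro ⟨σ, hσ, h, hs⟩
      rw [hreg σ hσ, not_not] at h
      exact h ▸ hs
    · intro h
      exact ⟨τ, hτ, by simp [hreg τ hτ], h⟩
  ext s
  simp only [coned, bdry, Set.mem_union, Set.mem_ofPred_eq, h1, Finset.ssubset_iff_subset_ne,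
    Finset.subset_insert_iff]
  by_cases hps : p ∈ s
  · simp only [hps, not_true_eq_false, false_and, true_and, false_or]
    rw [and_comm]
    refine and_congr_right fun hs => ?_
    constructor
    · rintro ⟨σ, hσ, hσr, hsσ⟩ rfl
      rw [Finset.erase_insert hpτ] at hsσ
      exact (hreg σ hσ).1 hσr (hτ.eq_of_subset hF hσ.1 hsσ)
    · intro hne
      have hns : ¬τ ⊆ s.erase p := fun h => hne (by
        rw [← h.antisymm' hs, Finset.insert_erase hps])
      obtain ⟨σ, hσ, hσ', h⟩ := hF.exists_facet_not_subset (hF.down _ hτ.1 _ hs) hns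
      exact ⟨σ, hσ, (hreg σ hσ).2 fun e => hσ' e.symm.le, h⟩
  · simp only [hps, not_false_eq_true, true_and, false_and, or_false, Finset.erase_eq_of_notMem]
    refine ⟨fun h => ⟨h, fun e => hps (e ▸ Finset.mem_insert_self _ _)⟩, fun h => h.1⟩

lemma ones_support (s : Finset V) : (ones s).support = s := by
  ext x; simp [ones_apply]

/-- Two ranked fans with a common facet are linked. -/
lemma linked_of_facet (hF : IsFan F) (hG : IsFan G) (hFr : Ranked F) (hGr : Ranked G)
    (hd : 1 < finrank ℝ V) {τ : Finset V} (hτ : Facet F τ) (hτ' : Facet G τ) : Linked F G := by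
  have hop : IsOpen {p | ∀ v ∈ τ, crd τ p v < 0} := by
    have : {p | ∀ v ∈ τ, crd τ p v < 0} = ⋂ v ∈ τ, {p | crd τ p v < 0} := by ext; simp
    rw [this]
    exact isOpen_biInter_finset fun v _ => isOpen_lt (hF.continuous_crd hτ v) continuous_const
  obtain ⟨q, hqU, hq, hq'⟩ := hF.exists_generic hG hop ⟨-comb (ones τ), fun v hv => by
    rw [hF.crd_neg hτ, hF.crd_eq hτ (ones_support τ).le rfl]
    simp [ones_apply, hv]⟩
  have hq0 : q ≠ 0 := by
    rintro rfl
    obtain ⟨v, hv⟩ : τ.Nonempty := Finset.card_pos.1 (by rw [hτ.2]; omega)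
    have := hqU v hv
    rw [show (0 : V) = (0 : ℝ) • (0 : V) by simp, hF.crd_smul hτ] at this
    simp at this
  have hn : 0 < ‖q‖⁻¹ := inv_pos.2 (norm_pos_iff.2 hq0)
  set p := ‖q‖⁻¹ • q with hp
  have hp1 : ‖p‖ = 1 := by
    rw [hp, norm_smul, norm_inv, norm_norm, inv_mul_cancel₀ (norm_ne_zero_iff.2 hq0)]
  have hneg : ∀ v ∈ τ, crd τ p v < 0 := by
    intro v hv
    rw [hp, hF.crd_smul hτ]
    exact mul_neg_of_pos_of_neg hn (hqU v hv)
  obtain ⟨r, hr⟩ := hFr p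
  obtain ⟨r', hr'⟩ := hGr p
  have h1 := linked_coned hF (hq.smul hF hn.ne') hp1 hd hr (A := ∅) (by simp) (by simp)
  have h2 := linked_coned hG (hq'.smul hG hn.ne') hp1 hd hr' (A := ∅) (by simp) (by simp)
  rw [coned_of_neg hF (hq.smul hF hn.ne') hd hτ hneg] at h1
  rw [coned_of_neg hG (hq'.smul hG hn.ne') hd hτ' hneg] at h2
  exact h1.trans h2.symm

/-- The unit vectors in `S` positively span the space with a unique linear dependence `l`. -/
structure PosCircuit (S : Finset V) (l : V →₀ ℝ) : Prop where
  unit : ∀ v ∈ S, ‖v‖ = 1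
  card : S.card = finrank ℝ V + 1
  support : l.support = S
  pos : ∀ v ∈ S, 0 < l v
  comb_eq : comb l = 0
  uniq : ∀ k : V →₀ ℝ, k.support ⊆ S → comb k = 0 → ∃ t : ℝ, k = t • l
  span : ∀ x, ∃ k : V →₀ ℝ, k.support ⊆ S ∧ comb k = x

lemma PosCircuit.isFan {S : Finset V} {l : V →₀ ℝ} (h : PosCircuit S l) : IsFan (bdry S) := by
  have hne : S.Nonempty := Finset.card_pos.1 (by rw [h.card]; omega)
  have hle : ∀ (c d : V →₀ ℝ) (t : ℝ), (∀ v, 0 ≤ d v) → c.support ⊂ S → c - d = t • l → t ≤ 0 := by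
    intro c d t hd hc heq
    by_contra! ht
    refine hc.2 fun v hv => ?_
    have := DFunLike.congr_fun heq v
    simp only [Finsupp.sub_apply, Finsupp.smul_apply, smul_eq_mul] at this
    rw [Finsupp.mem_support_iff]
    nlinarith [mul_pos ht (h.pos v hv), hd v]
  refine ⟨S.powerset.finite_toSet.subset fun s hs => by simpa using hs.1,
    Finset.empty_ssubset.2 hne, fun s hs t ht => lt_of_le_of_lt ht hs,
    fun s hs v hv => h.unit v (hs.1 hv), ?_, ?_⟩
  · intro c d hc hd hcS hdS heq
    obtain ⟨t, ht⟩ := h.uniq (c - d) (Finsupp.support_sub.trans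
      (Finset.union_subset hcS.1 hdS.1)) (by rw [map_sub, heq, sub_self])
    have h1 := hle c d t hd hcS ht
    have h2 := hle d c (-t) hc hdS (by rw [neg_smul, ← ht, neg_sub])
    have : t = 0 := by linarith
    rw [this, zero_smul, sub_eq_zero] at ht
    exact ht
  · intro x
    obtain ⟨k, hk, rfl⟩ := h.span x
    obtain ⟨m, hm, hmin⟩ := S.exists_min_image (fun v => k v / l v) hne
    have hlm := h.pos m hm
    have hz : (k - (k m / l m) • l) m = 0 := by
      simp only [Finsupp.sub_apply, Finsupp.smul_apply, smul_eq_mul]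
      rw [div_mul_cancel₀ _ hlm.ne', sub_self]
    have hsub : (k - (k m / l m) • l).support ⊆ S := Finsupp.support_sub.trans
      (Finset.union_subset hk (Finsupp.support_smul.trans h.support.le))
    refine ⟨k - (k m / l m) • l, fun v => ?_, ?_, by simp [h.comb_eq]⟩
    · by_cases hv : v ∈ S
      · have := hmin v hv
        rw [le_div_iff₀ (h.pos v hv)] at this
        simpa using this
      · rw [Finsupp.notMem_support_iff.1 fun hv' => hv (hsub hv')]
    · exact ⟨hsub, fun hS => Finsupp.mem_support_iff.1 (hS hm) hz⟩

lemma PosCircuit.facet {S : Finset V} {l : V →₀ ℝ} (h : PosCircuit S l) {v : V} (hv : v ∈ S) :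
    Facet (bdry S) (S.erase v) :=
  ⟨Finset.erase_ssubset hv, by rw [Finset.card_erase_of_mem hv, h.card]; rfl⟩

lemma PosCircuit.ranked {S : Finset V} {l : V →₀ ℝ} (h : PosCircuit S l) : Ranked (bdry S) := by
  intro p
  have hF := h.isFan
  refine exists_ranks hF (fun σ => Finsupp.linearCombination ℝ (fun _ => (1 : ℝ)) (crd σ p)) ?_
  intro τ τ' hτ hτ' c hadj _ hc
  obtain ⟨t, ht⟩ := h.uniq (crd τ p - crd τ' p) (Finsupp.support_sub.trans
    (Finset.union_subset ((crd_support _ _).trans hτ.1.1) ((crd_support _ _).trans hτ'.1.1)))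
    (by rw [map_sub, hF.comb_crd hτ, hF.comb_crd hτ', sub_self])
  have hcS : c ∈ S := hτ.1.1 hadj.1
  have h1 := DFunLike.congr_fun ht c
  simp only [Finsupp.sub_apply, Finsupp.smul_apply, smul_eq_mul, crd_eq_zero hadj.2.1,
    sub_zero] at h1
  have htpos : 0 < t := pos_of_mul_pos_left (h1 ▸ hc) (h.pos c hcS).le
  rw [← sub_pos, ← map_sub, ht, map_smul, smul_eq_mul]
  refine mul_pos htpos ?_
  rw [Finsupp.linearCombination_apply, Finsupp.sum, h.support]
  exact Finset.sum_pos (fun v hv => by simpa using h.pos v hv) ⟨c, hcS⟩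

/-- A basis of the space consisting of unit vectors. -/
structure Frame (τ : Finset V) : Prop where
  unit : ∀ v ∈ τ, ‖v‖ = 1
  card : τ.card = finrank ℝ V
  indep : ∀ k : V →₀ ℝ, k.support ⊆ τ → comb k = 0 → k = 0

lemma Facet.frame {τ : Finset V} (h : Facet F τ) (hF : IsFan F) : Frame τ :=
  ⟨hF.unit _ h.1, h.2, fun k hk h0 => hF.indep h.1 hk (k' := 0) (by simp) (by simp [h0])⟩

lemma Frame.span {τ : Finset V} (h : Frame τ) (x : V) :
    ∃ k : V →₀ ℝ, k.support ⊆ τ ∧ comb k = x := by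
  have hli : LinearIndepOn ℝ id (τ : Set V) := by
    rw [linearIndepOn_iff]
    exact fun l hl h0 => h.indep l (by simpa [Finsupp.mem_supported] using hl) h0
  have hspan : Submodule.span ℝ (τ : Set V) = ⊤ := by
    apply Submodule.eq_top_of_finrank_eq
    rw [finrank_span_finset_eq_card hli, h.card]
  have hv : x ∈ Submodule.span ℝ (id '' (τ : Set V)) := by simp [hspan]
  rw [Finsupp.mem_span_image_iff_linearCombination] at hv
  obtain ⟨k, hk, hkv⟩ := hv
  exact ⟨k, by simpa [Finsupp.mem_supported] using hk, hkv⟩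

lemma Frame.posCircuit {τ : Finset V} (h : Frame τ) {k : V →₀ ℝ} (hk : k.support ⊆ τ)
    (hneg : ∀ v ∈ τ, k v < 0) (hu : ‖comb k‖ = 1) :
    comb k ∉ τ ∧ PosCircuit (insert (comb k) τ) (Finsupp.single (comb k) 1 - k) := by
  set v := comb k with hv
  have hvτ : v ∉ τ := by
    intro hvτ
    have h0 := h.indep (k - Finsupp.single v 1) (Finsupp.support_sub.trans
      (Finset.union_subset hk (Finsupp.support_single_subset.trans (by simpa using hvτ))))
      (by simp [← hv])
    have := DFunLike.congr_fun h0 v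
    simp at this
    linarith [hneg v hvτ]
  have hkv : k v = 0 := Finsupp.notMem_support_iff.1 fun h' => hvτ (hk h')
  have hval : ∀ x ∈ τ, ((Finsupp.single v 1 - k : V →₀ ℝ)) x = -k x := by
    intro x hx
    have : x ≠ v := fun e => hvτ (e ▸ hx)
    simp [this]
  have hpos : ∀ x ∈ insert v τ, 0 < ((Finsupp.single v 1 - k : V →₀ ℝ)) x := by
    intro x hx
    rcases Finset.mem_insert.1 hx with rfl | hx
    · simp [hkv]
    · rw [hval x hx]; linarith [hneg x hx]
  have hsub : (Finsupp.single v 1 - k).support ⊆ insert v τ := Finsupp.support_sub.trans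
    (Finset.union_subset (Finsupp.support_single_subset.trans (by simp))
      (hk.trans (Finset.subset_insert _ _)))
  refine ⟨hvτ, ?_, ?_, ?_, hpos, by simp [← hv], ?_, ?_⟩
  · intro x hx
    rcases Finset.mem_insert.1 hx with rfl | hx
    · exact hu
    · exact h.unit x hx
  · rw [Finset.card_insert_of_notMem hvτ, h.card]
  · exact hsub.antisymm fun x hx => Finsupp.mem_support_iff.2 (hpos x hx).ne'
  · intro m hm h0
    refine ⟨m v, ?_⟩
    rw [← sub_eq_zero]
    refine h.indep _ (fun x hx => ?_) ?_
    · have h1 : x ≠ v := by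
        rintro rfl
        simp [hkv] at hx
      refine Finset.mem_of_mem_insert_of_ne (Finset.union_subset hm
        (Finsupp.support_smul.trans hsub) (Finsupp.support_sub hx)) h1
    · simp [h0, ← hv]
  · intro x
    obtain ⟨m, hm, hx⟩ := h.span x
    exact ⟨m, hm.trans (Finset.subset_insert _ _), hx⟩

/-- For a combination with negative coefficients of a frame, the fan spanned by the frame and the
normalized combination. -/
lemma Frame.exists_circuit {τ : Finset V} (h : Frame τ) (hd : 1 < finrank ℝ V) {k : V →₀ ℝ}
    (hk : k.support ⊆ τ) (hneg : ∀ v ∈ τ, k v < 0) :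
    0 < ‖comb k‖ ∧ ‖comb k‖⁻¹ • comb k ∉ τ ∧
      ∃ l, PosCircuit (insert (‖comb k‖⁻¹ • comb k) τ) l := by
  have h0 : comb k ≠ 0 := by
    intro h0
    obtain ⟨v, hv⟩ : τ.Nonempty := Finset.card_pos.1 (by rw [h.card]; omega)
    have := hneg v hv
    rw [h.indep k hk h0] at this
    simp at this
  have hn : 0 < ‖comb k‖ := norm_pos_iff.2 h0
  have key := h.posCircuit (k := ‖comb k‖⁻¹ • k) (Finsupp.support_smul.trans hk)
    (fun v hv => mul_neg_of_pos_of_neg (inv_pos.2 hn) (hneg v hv))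
    (by rw [map_smul, norm_smul, norm_inv, norm_norm, inv_mul_cancel₀ hn.ne'])
  rw [map_smul] at key
  exact ⟨hn, key.1, _, key.2⟩

lemma Frame.exists_fan {τ : Finset V} (h : Frame τ) (hd : 1 < finrank ℝ V) :
    ∃ F, IsFan F ∧ Facet F τ := by
  obtain ⟨-, h1, l, h2⟩ := h.exists_circuit hd (k := -ones τ)
    (by rw [Finsupp.support_neg, ones_support]) (fun v hv => by simp [ones_apply, hv])
  refine ⟨_, h2.isFan, ?_⟩
  have := h2.facet (Finset.mem_insert_self _ _)
  rwa [Finset.erase_insert h1] at this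

/-- Two frames are joined if they are facets of linked ranked fans. -/
def Joined (τ τ' : Finset V) : Prop :=
  ∃ F G, Ranked F ∧ Ranked G ∧ Facet F τ ∧ Facet G τ' ∧ Linked F G

lemma Joined.trans {τ τ' τ'' : Finset V} (h : Joined τ τ') (h' : Joined τ' τ'')
    (hd : 1 < finrank ℝ V) : Joined τ τ'' := by
  obtain ⟨F, G, hF, hG, hτ, hτ', hl⟩ := h
  obtain ⟨F', G', hF', hG', hτ₁, hτ₁', hl'⟩ := h'
  exact ⟨F, G', hF, hG', hτ, hτ₁', (hl.trans (linked_of_facet hl.isFan_right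
    hl'.symm.isFan_right hG hF' hd hτ' hτ₁)).trans hl'⟩

lemma PosCircuit.joined {S : Finset V} {l : V →₀ ℝ} (h : PosCircuit S l) {v w : V} (hv : v ∈ S)
    (hw : w ∈ S) : Joined (S.erase v) (S.erase w) :=
  ⟨_, _, h.ranked, h.ranked, h.facet hv, h.facet hw, Linked.refl h.isFan⟩

lemma Frame.exchange {τ : Finset V} (h : Frame τ) (hd : 1 < finrank ℝ V) {x y : V} (hx : x ∈ τ)
    (hy : ‖y‖ = 1) (hxy : crd τ y x ≠ 0) : Frame (insert y (τ.erase x)) := by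
  obtain ⟨F, hF, hτ⟩ := h.exists_fan hd
  refine ⟨fun v hv => ?_, ?_, fun k hk h0 => ?_⟩
  · rcases Finset.mem_insert.1 hv with rfl | hv
    · exact hy
    · exact h.unit v (Finset.mem_of_mem_erase hv)
  · rw [Finset.card_insert_of_notMem, Finset.card_erase_add_one hx, h.card]
    intro hyτ
    rw [Finset.mem_erase] at hyτ
    rw [hF.crd_self hτ hyτ.2] at hxy
    simp [hyτ.1.symm] at hxy
  · have hke : (k.erase y).support ⊆ τ.erase x := by
      rw [Finsupp.support_erase]
      exact Finset.subset_insert_iff.1 hk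
    have hkeq : Finsupp.single y (k y) + k.erase y = k := Finsupp.single_add_erase y k
    have key := h.indep (k y • crd τ y + k.erase y) (Finsupp.support_add.trans
      (Finset.union_subset (Finsupp.support_smul.trans (crd_support _ _))
        (hke.trans (Finset.erase_subset _ _)))) (by
          rw [map_add, map_smul, hF.comb_crd hτ, ← h0]
          conv_rhs => rw [← hkeq]
          simp)
    have hx0 : k.erase y x = 0 := Finsupp.notMem_support_iff.1 fun h' => by
      simpa using hke h'
    have h1 := DFunLike.congr_fun key x
    simp only [Finsupp.add_apply, Finsupp.smul_apply, smul_eq_mul, hx0, add_zero,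
      Finsupp.zero_apply, mul_eq_zero, hxy, or_false] at h1
    rw [h1, zero_smul, zero_add] at key
    rw [← hkeq, h1, key]
    simp

lemma Frame.crd_exchange {τ : Finset V} (h : Frame τ) (hd : 1 < finrank ℝ V) {x y : V}
    (hx : x ∈ τ) (hy : ‖y‖ = 1) (hxy : crd τ y x ≠ 0) (p : V) :
    crd τ p x = crd (insert y (τ.erase x)) p y * crd τ y x := by
  obtain ⟨F, hF, hτ⟩ := h.exists_fan hd
  obtain ⟨G, hG, hσ⟩ := (h.exchange hd hx hy hxy).exists_fan hd
  set k := crd (insert y (τ.erase x)) p with hk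
  have hke : (k.erase y).support ⊆ τ.erase x := by
    rw [Finsupp.support_erase]
    exact Finset.subset_insert_iff.1 (crd_support _ _)
  have hkeq : Finsupp.single y (k y) + k.erase y = k := Finsupp.single_add_erase y k
  have key : crd τ p = k y • crd τ y + k.erase y := by
    refine hF.crd_eq hτ (Finsupp.support_add.trans
      (Finset.union_subset (Finsupp.support_smul.trans (crd_support _ _))
        (hke.trans (Finset.erase_subset _ _)))) ?_
    rw [map_add, map_smul, hF.comb_crd hτ, ← hG.comb_crd hσ p, ← hk]
    conv_rhs => rw [← hkeq]
    simp
  have hx0 : k.erase y x = 0 := Finsupp.notMem_support_iff.1 fun h' => by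
    simpa using hke h'
  rw [key]
  simp [hx0]

lemma Frame.joined_of_pos {τ : Finset V} (h : Frame τ) (hd : 1 < finrank ℝ V) {x y : V}
    (hx : x ∈ τ) (hy : ‖y‖ = 1) (hxy : 0 < crd τ y x) : Joined τ (insert y (τ.erase x)) := by
  have h' := h.exchange hd hx hy hxy.ne'
  obtain ⟨F, hF, hτ⟩ := h.exists_fan hd
  obtain ⟨G, hG, hσ⟩ := h'.exists_fan hd
  set σ := insert y (τ.erase x) with hσdef
  set k := crd σ x with hk
  have hxk : k y * crd τ y x = 1 := by
    rw [hk, ← h.crd_exchange hd hx hy hxy.ne' x, hF.crd_self hτ hx]; simp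
  have hky : 0 < k y := pos_of_mul_pos_left (by rw [hxk]; exact one_pos) hxy.le
  set M : ℝ := 1 + ∑ v ∈ τ, |k v| with hM
  have hMpos : 0 < M := by
    have : 0 ≤ ∑ v ∈ τ, |k v| := Finset.sum_nonneg fun v _ => abs_nonneg _
    linarith
  have hMk : ∀ v ∈ τ, -k v < M := by
    intro v hv
    have := Finset.single_le_sum (f := fun v => |k v|) (fun i _ => abs_nonneg _) hv
    have h2 := neg_abs_le (k v)
    linarith
  have hyρ : y ∉ τ.erase x := fun hyρ => by
    have h1 := h'.card
    have h2 := h.card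
    rw [hσdef, Finset.insert_eq_of_mem hyρ] at h1
    have := Finset.card_erase_add_one hx
    omega
  set K₁ : V →₀ ℝ := -(Finsupp.single x 1 + M • ones (τ.erase x)) with hK₁
  set K₂ : V →₀ ℝ := -(k + M • ones (τ.erase x)) with hK₂
  have hcomb : comb K₂ = comb K₁ := by
    simp only [hK₁, hK₂, map_neg, map_add, hk, hG.comb_crd hσ]
    simp
  obtain ⟨hn, hv₁, l₁, hc₁⟩ := h.exists_circuit hd (k := K₁) (by
      rw [hK₁, Finsupp.support_neg]
      refine Finsupp.support_add.trans (Finset.union_subset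
        (Finsupp.support_single_subset.trans (by simpa using hx)) ?_)
      exact Finsupp.support_smul.trans ((ones_support _).le.trans (Finset.erase_subset _ _))) (by
      intro v hv
      by_cases hvx : v = x
      · simp [hK₁, hvx, ones_apply]
      · simpa [hK₁, hvx, Ne.symm hvx, ones_apply, hv] using hMpos)
  obtain ⟨-, hv₂, l₂, hc₂⟩ := h'.exists_circuit hd (k := K₂) (by
      rw [hK₂, Finsupp.support_neg]
      refine Finsupp.support_add.trans (Finset.union_subset (crd_support _ _) ?_)
      exact Finsupp.support_smul.trans ((ones_support _).le.trans (Finset.subset_insert _ _))) (by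
      intro v hv
      rcases Finset.mem_insert.1 hv with rfl | hv
      · simpa [hK₂, ones_apply, -Finset.mem_erase, hyρ] using hky
      · have := hMk v (Finset.mem_of_mem_erase hv)
        simp only [hK₂, ones_apply, Finsupp.neg_apply, Finsupp.add_apply, Finsupp.smul_apply,
          hv, if_true, smul_eq_mul]
        linarith)
  rw [hcomb] at hv₂ hc₂
  set v := ‖comb K₁‖⁻¹ • comb K₁
  have hvx : v ≠ x := fun e => hv₁ (e ▸ hx)
  have hvy : v ≠ y := fun e => hv₂ (e ▸ Finset.mem_insert_self _ _)
  have j₁ := hc₁.joined (Finset.mem_insert_self v τ) (Finset.mem_insert_of_mem hx)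
  have j₂ := hc₂.joined (Finset.mem_insert_of_mem (Finset.mem_insert_self y _))
    (Finset.mem_insert_self v σ)
  rw [Finset.erase_insert hv₁, Finset.erase_insert_of_ne hvx] at j₁
  rw [Finset.erase_insert hv₂, Finset.erase_insert_of_ne hvy, hσdef,
    Finset.erase_insert hyρ] at j₂
  exact j₁.trans j₂ hd

lemma Frame.joined_exchange {τ : Finset V} (h : Frame τ) (hd : 1 < finrank ℝ V) {x y : V}
    (hx : x ∈ τ) (hy : ‖y‖ = 1) (hxy : crd τ y x ≠ 0) : Joined τ (insert y (τ.erase x)) := by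
  rcases hxy.lt_or_gt with hlt | hgt
  · obtain ⟨F, hF, hτ⟩ := h.exists_fan hd
    obtain ⟨hn, hv, l, hc⟩ := h.exists_circuit hd (k := -ones τ)
      (by rw [Finsupp.support_neg, ones_support]) (fun v hv => by simp [ones_apply, hv])
    have hcrd : crd τ (‖comb (-ones τ)‖⁻¹ • comb (-ones τ)) x < 0 := by
      rw [hF.crd_smul hτ, hF.crd_eq hτ (k := -ones τ) (by rw [Finsupp.support_neg, ones_support])
        rfl]
      simpa [ones_apply, hx] using hn
    set v := ‖comb (-ones τ)‖⁻¹ • comb (-ones τ)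
    have hvx : v ≠ x := fun e => hv (e ▸ hx)
    have hv1 : ‖v‖ = 1 := hc.unit v (Finset.mem_insert_self _ _)
    have j := hc.joined (Finset.mem_insert_self v τ) (Finset.mem_insert_of_mem hx)
    rw [Finset.erase_insert hv, Finset.erase_insert_of_ne hvx] at j
    have h1 := h.crd_exchange hd hx hv1 hcrd.ne y
    have hpos : 0 < crd (insert v (τ.erase x)) y v := by
      by_contra! hle
      have := mul_nonneg_of_nonpos_of_nonpos hle hcrd.le
      linarith
    have j₂ := (h.exchange hd hx hv1 hcrd.ne).joined_of_pos hd (Finset.mem_insert_self _ _) hy hpos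
    rw [Finset.erase_insert fun e => hv (Finset.mem_of_mem_erase e)] at j₂
    exact j.trans j₂ hd
  · exact h.joined_of_pos hd hx hy hgt

lemma Frame.joined_refl {τ : Finset V} (h : Frame τ) (hd : 1 < finrank ℝ V) : Joined τ τ := by
  obtain ⟨-, hv, l, hc⟩ := h.exists_circuit hd (k := -ones τ)
    (by rw [Finsupp.support_neg, ones_support]) (fun v hv => by simp [ones_apply, hv])
  have := hc.joined (Finset.mem_insert_self _ _) (Finset.mem_insert_self _ _)
  rwa [Finset.erase_insert hv] at this

lemma Frame.joined {τ' : Finset V} (h' : Frame τ') (hd : 1 < finrank ℝ V) (n : ℕ) :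
    ∀ τ : Finset V, Frame τ → (τ' \ τ).card = n → Joined τ τ' := by
  induction n with
  | zero =>
    intro τ h hn
    have hsub : τ' ⊆ τ := Finset.sdiff_eq_empty_iff_subset.1 (Finset.card_eq_zero.1 hn)
    have : τ' = τ := Finset.eq_of_subset_of_card_le hsub (by rw [h.card, h'.card])
    exact this ▸ h'.joined_refl hd
  | succ n ih =>
    intro τ h hn
    obtain ⟨y, hy⟩ : (τ' \ τ).Nonempty := Finset.card_pos.1 (by omega)
    obtain ⟨hyτ', hyτ⟩ := Finset.mem_sdiff.1 hy
    obtain ⟨F, hF, hτ⟩ := h.exists_fan hd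
    obtain ⟨x, hxτ', hxy⟩ : ∃ x, x ∉ τ' ∧ crd τ y x ≠ 0 := by
      by_contra! hall
      have h0 := h'.indep (crd τ y - Finsupp.single y 1) (Finsupp.support_sub.trans
        (Finset.union_subset (fun x hx => ?_)
          (Finsupp.support_single_subset.trans (by simpa using hyτ'))))
        (by simp [hF.comb_crd hτ])
      · have := DFunLike.congr_fun h0 y
        simp [crd_eq_zero hyτ] at this
      · by_contra hxτ'
        exact Finsupp.mem_support_iff.1 hx (hall x hxτ')
    have hx : x ∈ τ := by
      by_contra hx
      exact hxy (crd_eq_zero hx)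
    have hy1 := h'.unit y hyτ'
    refine (h.joined_exchange hd hx hy1 hxy).trans (ih _ (h.exchange hd hx hy1 hxy) ?_) hd
    have : τ' \ insert y (τ.erase x) = (τ' \ τ).erase y := by
      ext z
      simp only [Finset.mem_sdiff, Finset.mem_insert, Finset.mem_erase]
      have : z ∈ τ' → z ≠ x := fun hz e => hxτ' (e ▸ hz)
      tauto
    rw [this, Finset.card_erase_of_mem hy, hn]
    rfl

lemma Ranked.linked (hFr : Ranked F) (hGr : Ranked G) (hF : IsFan F) (hG : IsFan G)
    (hd : 1 < finrank ℝ V) : Linked F G := by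
  obtain ⟨τ, hτ, -⟩ := hF.exists_facet hF.empty_mem
  obtain ⟨σ, hσ, -⟩ := hG.exists_facet hG.empty_mem
  obtain ⟨F', G', hF', hG', h1, h2, hl⟩ := (hσ.frame hG).joined hd _ τ (hτ.frame hF) rfl
  have hFlink := linked_of_facet hF hl.symm.isFan_right hFr hF' hd hτ h1
  have hGlink := linked_of_facet hl.isFan_right hG hG' hGr hd h2 hσ
  exact (hFlink.trans hl).trans hGlink

/-- Any two complete simplicial fans in a four-dimensional space are linked. -/
theorem linked_of_finrank (hF : IsFan F) (hG : IsFan G) (hd : finrank ℝ V = 4) : Linked F G := by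
  obtain ⟨F', h1, h2⟩ := hF.exists_ranked hd
  obtain ⟨G', h3, h4⟩ := hG.exists_ranked hd
  exact (h1.trans (h2.linked h4 h1.isFan_right h3.isFan_right (by omega))).trans h3.symm

end Endgame

section Bridge

lemma Move.symm {V : Type*} [NormedAddCommGroup V] [InnerProductSpace ℝ V] [DecidableEq V]
    {F G : Set (Finset V)} (hF : IsFan F) (h : Move F G) : Move G F := by
  obtain ⟨A, B, hA, hAne, hBne, hB, hAB, hcard, hst, rfl⟩ := h
  have hnAB : ¬A ⊆ B := fun h => hAne.ne_empty (disjoint_self.1 (hAB.mono_right h))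
  have hnBA : ¬B ⊆ A := fun h => hBne.ne_empty (disjoint_self.1 (hAB.mono_left h))
  have hBs : ∀ s ∈ F, ¬B ⊆ s := fun s hs h => hB (hF.down s hs B h)
  refine ⟨B, A, Or.inr ⟨subset_rfl, Finset.subset_union_right, hnAB⟩, hBne, hAne, ?_, hAB.symm,
    by omega, fun s hs => ?_, ?_⟩
  · rintro (h | h)
    · exact h.2 subset_rfl
    · exact hnBA h.1
  · rw [Finset.union_comm]
    constructor
    · rintro (h | h)
      · exact absurd hs (hBs s h.1)
      · exact h.2
    · exact fun h => Or.inr ⟨hs, h⟩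
  · rw [Finset.union_comm B A]
    ext s
    constructor
    · intro h
      by_cases hAs : A ⊆ s
      · exact Or.inr ⟨hAs, (hst s hAs).1 h⟩
      · exact Or.inl ⟨Or.inl ⟨h, hAs⟩, hBs s h⟩
    · rintro (⟨h | h, h'⟩ | h)
      · exact h.1
      · exact absurd h.1 h'
      · exact (hst s h.1).2 h.2

variable {n : ℕ}

lemma comb_eq_sum {V : Type*} [NormedAddCommGroup V] [InnerProductSpace ℝ V] {c : V →₀ ℝ}
    {s : Finset V} (h : c.support ⊆ s) : comb c = ∑ v ∈ s, c v • v :=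
  Finsupp.sum_of_support_subset _ h _ (by simp)

/-- Membership in a spherical simplex in terms of nonnegative coefficients. -/
lemma mem_sphSimplex {s : Finset (EuclideanSpace ℝ (Fin n))} {x : EuclideanSpace ℝ (Fin n)} :
    x ∈ sphSimplex s ↔ ‖x‖ = 1 ∧ ∃ c : EuclideanSpace ℝ (Fin n) →₀ ℝ,
      (∀ v, 0 ≤ c v) ∧ c.support ⊆ s ∧ comb c = x := by
  constructor
  · rintro ⟨y, ⟨hy, hy0⟩, rfl⟩
    have hy0 : y ≠ 0 := hy0
    obtain ⟨w, hw, -, hwy⟩ := Finset.mem_convexHull'.1 hy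
    have hsupp : (Finsupp.indicator s fun v _ => w v).support ⊆ s :=
      Finsupp.support_indicator_subset _ _
    refine ⟨by simp [norm_smul, hy0], ‖y‖⁻¹ • Finsupp.indicator s fun v _ => w v, fun v => ?_,
      Finsupp.support_smul.trans hsupp, ?_⟩
    · rw [Finsupp.smul_apply, Finsupp.indicator_apply]
      split_ifs with h
      · exact mul_nonneg (by positivity) (hw v h)
      · simp
    · rw [map_smul, comb_eq_sum hsupp]
      refine congrArg (‖y‖⁻¹ • ·) (Eq.trans (Finset.sum_congr rfl fun v hv => ?_) hwy)
      simp [Finsupp.indicator_apply, hv]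
  · rintro ⟨hx, c, hc, hcs, hcx⟩
    have hx0 : x ≠ 0 := fun h => by simp [h] at hx
    have hpos : 0 < ∑ v ∈ s, c v := by
      refine (Finset.sum_nonneg fun v _ => hc v).lt_of_ne' fun h => hx0 ?_
      rw [← hcx, comb_eq_sum hcs]
      refine Finset.sum_eq_zero fun v hv => ?_
      rw [(Finset.sum_eq_zero_iff_of_nonneg fun v _ => hc v).1 h v hv, zero_smul]
    set S := ∑ v ∈ s, c v
    refine ⟨S⁻¹ • x, ⟨Finset.mem_convexHull'.2 ⟨fun v => S⁻¹ * c v, fun v _ => ?_, ?_, ?_⟩, ?_⟩, ?_⟩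
    · exact mul_nonneg (inv_nonneg.2 hpos.le) (hc v)
    · rw [← Finset.mul_sum, inv_mul_cancel₀ hpos.ne']
    · rw [← hcx, comb_eq_sum hcs, Finset.smul_sum]
      simp only [mul_smul]
    · exact smul_ne_zero (inv_ne_zero hpos.ne') hx0
    · change ‖S⁻¹ • x‖⁻¹ • S⁻¹ • x = x
      rw [norm_smul, hx, mul_one, norm_inv, Real.norm_of_nonneg hpos.le, inv_inv,
        smul_inv_smul₀ hpos.ne']

lemma comb_injOn_of_linearIndependent {V : Type*} [NormedAddCommGroup V] [InnerProductSpace ℝ V]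
    {s : Finset V} (h : LinearIndependent ℝ (fun v : {x // x ∈ s} => (v : V))) {c d : V →₀ ℝ}
    (hc : c.support ⊆ s) (hd : d.support ⊆ s) (hcd : comb c = comb d) : c = d :=
  have h' : LinearIndepOn ℝ (id : V → V) (s : Set V) := h
  linearIndepOn_iffₛ.1 h' c ((Finsupp.mem_supported ℝ c).2 (Finset.coe_subset.2 hc))
    d ((Finsupp.mem_supported ℝ d).2 (Finset.coe_subset.2 hd)) hcd

/-- The fan of cones over the simplices of a triangulation of the sphere. -/
lemma isFan_insert_faces (K : SphericalComplex n)
    (hK : K.space = {x : EuclideanSpace ℝ (Fin (n + 1)) | ‖x‖ = 1}) :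
    IsFan (insert ∅ K.faces) where
  finite := K.finite'.insert _
  empty_mem := Set.mem_insert _ _
  down := by
    intro s hs t hts
    rcases t.eq_empty_or_nonempty with rfl | ht
    · exact Set.mem_insert _ _
    · rcases hs with rfl | hs
      · exact absurd (Finset.subset_empty.1 hts) ht.ne_empty
      · exact Or.inr (K.down_closed s hs t hts ht)
  unit := by
    rintro s (rfl | hs)
    · simp
    · exact K.unit s hs
  inj := by
    have key : ∀ d : EuclideanSpace ℝ (Fin (n + 1)) →₀ ℝ, d.support ∈ insert ∅ K.faces →
        comb d = 0 → d = 0 := by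
      rintro d (hd | hd) h
      · exact Finsupp.support_eq_empty.1 hd
      · exact comb_injOn_of_linearIndependent (K.indep _ hd) subset_rfl (by simp) (by simpa using h)
    intro c d hc hd hcs hds hcd
    by_cases h0 : comb c = 0
    · rw [key c hcs h0, key d hds (hcd ▸ h0)]
    have hcs : c.support ∈ K.faces := hcs.resolve_left fun h => h0 (by
      rw [Finsupp.support_eq_empty.1 h, map_zero])
    have hds : d.support ∈ K.faces := hds.resolve_left fun h => h0 (by
      rw [hcd, Finsupp.support_eq_empty.1 h, map_zero])
    have hr : ‖comb c‖ ≠ 0 := norm_ne_zero_iff.2 h0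
    have hmem : ∀ e : EuclideanSpace ℝ (Fin (n + 1)) →₀ ℝ, (∀ v, 0 ≤ e v) → comb e = comb c →
        ‖comb c‖⁻¹ • comb c ∈ sphSimplex e.support := fun e he hec =>
      mem_sphSimplex.2 ⟨by rw [norm_smul, norm_inv, norm_norm, inv_mul_cancel₀ hr],
        ‖comb c‖⁻¹ • e, fun v => mul_nonneg (by positivity) (he v), Finsupp.support_smul,
        by rw [map_smul, hec]⟩
    have hx : ‖comb c‖⁻¹ • comb c ∈ sphSimplex (c.support ∩ d.support) := by
      rw [← K.inter _ hcs _ hds]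
      exact ⟨hmem c hc rfl, hmem d hd hcd.symm⟩
    obtain ⟨-, e, -, hes, hec⟩ := mem_sphSimplex.1 hx
    have hec' : comb (‖comb c‖ • e) = comb c := by rw [map_smul, hec, smul_inv_smul₀ hr]
    rw [← comb_injOn_of_linearIndependent (K.indep _ hcs)
        ((Finsupp.support_smul.trans hes).trans Finset.inter_subset_left) subset_rfl hec',
      ← comb_injOn_of_linearIndependent (K.indep _ hds)
        ((Finsupp.support_smul.trans hes).trans Finset.inter_subset_right) subset_rfl
        (hec'.trans hcd)]
  surj := by
    intro x
    rcases eq_or_ne x 0 with rfl | hx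
    · exact ⟨0, by simp, by simp, by simp⟩
    have hr : ‖x‖ ≠ 0 := norm_ne_zero_iff.2 hx
    have hmem : ‖x‖⁻¹ • x ∈ K.space := by
      rw [hK]
      change ‖‖x‖⁻¹ • x‖ = 1
      rw [norm_smul, norm_inv, norm_norm, inv_mul_cancel₀ hr]
    obtain ⟨s, hs, hxs⟩ := Set.mem_iUnion₂.1 hmem
    obtain ⟨-, c, hc, hcs, hcx⟩ := mem_sphSimplex.1 hxs
    refine ⟨‖x‖ • c, fun v => mul_nonneg (norm_nonneg _) (hc v), ?_, ?_⟩
    · rw [Set.mem_insert_iff, or_iff_not_imp_left]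
      exact fun h => K.down_closed s hs _ (Finsupp.support_smul.trans hcs)
        (Finset.nonempty_iff_ne_empty.2 h)
    · rw [map_smul, hcx, smul_inv_smul₀ hr]

/-- The spherical complex cut out on the unit sphere by a complete simplicial fan. -/
def toComplex (F : {F : Set (Finset (EuclideanSpace ℝ (Fin (n + 1)))) // IsFan F}) :
    SphericalComplex n where
  faces := F.1 \ {∅}
  finite' := F.2.finite.subset Set.sdiff_subset
  nonempty_mem s hs := Finset.nonempty_iff_ne_empty.2 hs.2
  unit s hs := F.2.unit s hs.1
  indep s hs := F.2.linearIndepOn hs.1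
  down_closed s hs t hts ht := ⟨F.2.down s hs.1 t hts, ht.ne_empty⟩
  inter s hs t ht := by
    ext x
    constructor
    · rintro ⟨hxs, hxt⟩
      obtain ⟨hx, c, hc, hcs, hcx⟩ := mem_sphSimplex.1 hxs
      obtain ⟨-, d, hd, hdt, hdx⟩ := mem_sphSimplex.1 hxt
      obtain rfl := F.2.inj c d hc hd (F.2.down s hs.1 _ hcs) (F.2.down t ht.1 _ hdt)
        (hcx.trans hdx.symm)
      exact mem_sphSimplex.2 ⟨hx, c, hc, Finset.subset_inter hcs hdt, hcx⟩
    · intro h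
      obtain ⟨hx, c, hc, hcs, hcx⟩ := mem_sphSimplex.1 h
      exact ⟨mem_sphSimplex.2 ⟨hx, c, hc, hcs.trans Finset.inter_subset_left, hcx⟩,
        mem_sphSimplex.2 ⟨hx, c, hc, hcs.trans Finset.inter_subset_right, hcx⟩⟩

lemma toComplex_insert_faces (K : SphericalComplex n)
    (hF : IsFan (insert ∅ K.faces)) : toComplex ⟨insert ∅ K.faces, hF⟩ = K := by
  have h : insert ∅ K.faces \ {∅} = K.faces := by
    refine Set.insert_sdiff_self_of_notMem fun h => ?_
    simpa using K.nonempty_mem _ h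
  obtain ⟨faces, _, _, _, _, _, _⟩ := K
  exact (SphericalComplex.mk.injEq ..).mpr h

lemma Move.sphBistellarMove
    {F G : {F : Set (Finset (EuclideanSpace ℝ (Fin (n + 1)))) // IsFan F}} (h : Move F.1 G.1) :
    SphBistellarMove (toComplex F) (toComplex G) := by
  obtain ⟨A, B, hA, hAne, hBne, hB, hAB, hcard, hst, hG⟩ := h
  refine ⟨A, B, ⟨hA, hAne.ne_empty⟩, fun h => hB h.1, hBne, ?_, ?_, ?_⟩
  · rw [hcard, finrank_euclideanSpace_fin]
  · ext C
    constructor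
    · rintro ⟨hC, hAC, hACF, -⟩
      obtain ⟨h1, h2⟩ := (hst _ Finset.subset_union_left).1 hACF
      exact ⟨hC, hAC.symm.left_le_of_le_sup_left (Finset.subset_union_right.trans h1),
        fun h => h2 (h.trans Finset.subset_union_right)⟩
    · rintro ⟨hC, hCB, hBC⟩
      exact ⟨hC, hAB.mono_right hCB, (hst _ Finset.subset_union_left).2
        ⟨Finset.union_subset_union_right hCB, fun h => hBC (hAB.symm.left_le_of_le_sup_left h)⟩,
        (hC.mono Finset.subset_union_right).ne_empty⟩
  · change G.1 \ {∅} = (F.1 \ {∅}) \ _ ∪ _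
    rw [hG]
    ext s
    constructor
    · rintro ⟨h | ⟨h1, h2, h3⟩, h0⟩
      · exact Or.inl ⟨⟨h.1, h0⟩, h.2⟩
      · refine Or.inr ⟨s \ B, ⟨?_, fun h => h3 (h.trans Finset.sdiff_subset)⟩,
          (Finset.sdiff_union_of_subset h1).symm⟩
        exact sdiff_le_iff.2 (by rwa [Finset.union_comm] at h2)
    · rintro (⟨⟨h1, h0⟩, h2⟩ | ⟨A', hA', rfl⟩)
      · exact ⟨Or.inl ⟨h1, h2⟩, h0⟩
      · exact ⟨Or.inr ⟨Finset.subset_union_right, Finset.union_subset_union_left hA'.1,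
          fun h => hA'.2 (hAB.left_le_of_le_sup_right h)⟩,
          (hBne.mono Finset.subset_union_right).ne_empty⟩

lemma Linked.reflTransGen {F G : Set (Finset (EuclideanSpace ℝ (Fin (n + 1))))}
    (hF : IsFan F) (hG : IsFan G) (h : Linked F G) :
    Relation.ReflTransGen SphBistellarMove (toComplex ⟨F, hF⟩) (toComplex ⟨G, hG⟩) := by
  obtain ⟨_, _, h⟩ := h
  suffices ∀ a b : {F : Set (Finset (EuclideanSpace ℝ (Fin (n + 1)))) // IsFan F},
      Relation.EqvGen (fun a b => Move a.1 b.1) a b →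
      Relation.ReflTransGen SphBistellarMove (toComplex a) (toComplex b) ∧
        Relation.ReflTransGen SphBistellarMove (toComplex b) (toComplex a) from (this _ _ h).1
  intro a b h
  induction h with
  | rel a b h =>
    exact ⟨.single h.sphBistellarMove, .single (Move.sphBistellarMove (Move.symm a.2 h))⟩
  | refl a => exact ⟨.refl, .refl⟩
  | symm a b _ ih => exact ih.symm
  | trans a b c _ _ ih₁ ih₂ => exact ⟨ih₁.1.trans ih₂.1, ih₂.2.trans ih₁.2⟩

end Bridge

end SphFan

/-- Let `K₁`, `K₂` be geometric simplicial triangulations of the round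
3-sphere `S³` (by spherical geodesic simplices) in which the star of every simplex has diameter
less than `π` in the intrinsic (angular) metric. Then `K₁` and `K₂` are related by a finite
sequence of geometric bistellar moves (no derived subdivisions are needed). -/
theorem statement15 (K₁ K₂ : SphericalComplex 3)
    (hK₁ : K₁.space = {x : EuclideanSpace ℝ (Fin 4) | ‖x‖ = 1})
    (hK₂ : K₂.space = {x : EuclideanSpace ℝ (Fin 4) | ‖x‖ = 1})
    (hstar₁ : ∀ A ∈ K₁.faces, ∀ x ∈ sphStar K₁ A, ∀ y ∈ sphStar K₁ A,
      Real.arccos ⟪x, y⟫ < Real.pi)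
    (hstar₂ : ∀ A ∈ K₂.faces, ∀ x ∈ sphStar K₂ A, ∀ y ∈ sphStar K₂ A,
      Real.arccos ⟪x, y⟫ < Real.pi) :
    Relation.ReflTransGen SphBistellarMove K₁ K₂ := by

  have h₁ := SphFan.isFan_insert_faces K₁ hK₁
  have h₂ := SphFan.isFan_insert_faces K₂ hK₂
  rw [← SphFan.toComplex_insert_faces K₁ h₁, ← SphFan.toComplex_insert_faces K₂ h₂]
  exact (SphFan.linked_of_finrank h₁ h₂ finrank_euclideanSpace_fin).reflTransGen h₁ h₂
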